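/- (Ohm) Let q and q′ be nondegenerate quadratic forms of rank 4 over a field k of characteristic ≠ 2. If there exist k-algebra homomorphisms k(q) → k(q′) and k(q′) → k(q) (i.e., the function fields of the corresponding quadric surfaces are isogenous), then either q and q′ are both isotropic, or q and q′ are similar. -/

import Mathlib

open scoped TensorProduct
open Quaternion
set_option synthInstance.maxHeartbeats 1000000
set_option maxHeartbeats 1000000
noncomputable section

universe u v

/-- Upper-triangular coefficient matrix of a quadratic form on `Fin n → R`. -/
def coeffMatrix {R : Type*} [CommRing R] {n : ℕ} (q : QuadraticForm R (Fin n → R)) :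
    Matrix (Fin n) (Fin n) R :=
  Matrix.of fun i j =>
    if i = j then q (Pi.single i 1)
    else if i < j then QuadraticMap.polar q (Pi.single i 1) (Pi.single j 1)
    else 0

/-- Base change of a quadratic form on `Fin n → R` along `R → l`. -/
def extendQF {R : Type*} [CommRing R] {n : ℕ} (q : QuadraticForm R (Fin n → R))
    (l : Type*) [CommRing l] [Algebra R l] : QuadraticForm l (Fin n → l) :=
  ((coeffMatrix q).map (algebraMap R l)).toQuadraticMap'

/-- Gram matrix of the polar bilinear form of `q`. -/
def polarMatrix {R : Type*} [CommRing R] {n : ℕ} (q : QuadraticForm R (Fin n → R)) :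
    Matrix (Fin n) (Fin n) R :=
  Matrix.of fun i j => QuadraticMap.polar q (Pi.single i 1) (Pi.single j 1)

/-- Discriminant: determinant of the Gram matrix (well defined up to squares). -/
def discQF {R : Type*} [CommRing R] {n : ℕ} (q : QuadraticForm R (Fin n → R)) : R :=
  (polarMatrix q).det

/-- Nondegeneracy (char ≠ 2): the Gram determinant is nonzero. -/
def NondegQF {R : Type*} [CommRing R] {n : ℕ} (q : QuadraticForm R (Fin n → R)) : Prop :=
  discQF q ≠ 0

/-- Two quadratic forms are similar if one is isometric to a unit scaling of the other. -/
def SimilarQF {R : Type*} [CommRing R] {n : ℕ} (q q' : QuadraticForm R (Fin n → R)) : Prop :=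
  ∃ c : R, IsUnit c ∧ QuadraticMap.Equivalent (c • q) q'

/-- The polynomial `q(X₁, …, X_{n-1}, 1)` defining the affine quadric. -/
def affineQuadricPoly {R : Type*} [CommRing R] {n : ℕ} (q : QuadraticForm R (Fin n → R)) :
    MvPolynomial (Fin (n - 1)) R :=
  (extendQF q (MvPolynomial (Fin (n - 1)) R))
    (fun i => if h : (i : ℕ) < n - 1 then MvPolynomial.X ⟨i, h⟩ else 1)

/-- Affine coordinate ring `R[x₁,…,x_{n-1}]/(q(x₁,…,x_{n-1},1))` of the quadric. -/
abbrev quadricCoordRing {R : Type*} [CommRing R] {n : ℕ}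
    (q : QuadraticForm R (Fin n → R)) : Type _ :=
  MvPolynomial (Fin (n - 1)) R ⧸ Ideal.span {affineQuadricPoly q}

/-- Function field `k(q)` of the quadric hypersurface `q = 0`. -/
abbrev quadricFunctionField {R : Type*} [CommRing R] {n : ℕ}
    (q : QuadraticForm R (Fin n → R)) : Type _ :=
  FractionRing (quadricCoordRing q)

/-- Affine coordinate ring `k[x,y]/(ax²+by²-1)` of the conic `C_{a,b}`. -/
abbrev conicCoordRing (k : Type*) [Field k] (a b : k) : Type _ :=
  MvPolynomial (Fin 2) k ⧸
    Ideal.span {(MvPolynomial.C a * MvPolynomial.X 0 ^ 2 +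
      MvPolynomial.C b * MvPolynomial.X 1 ^ 2 - 1 : MvPolynomial (Fin 2) k)}

/-- The conic function field `k(C_{a,b})`. -/
abbrev conicFunctionField (k : Type*) [Field k] (a b : k) : Type _ :=
  FractionRing (conicCoordRing k a b)

/-- A `k`-algebra is split if it is isomorphic to a matrix algebra over `k`. -/
def IsSplitAlg (k A : Type*) [Field k] [Ring A] [Algebra k A] : Prop :=
  ∃ n : ℕ, 0 < n ∧ Nonempty (A ≃ₐ[k] Matrix (Fin n) (Fin n) k)

/-- `A` is split by the extension `K/k`: the class of `A` lies in the Brauer kernel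
`κ(K/k) = ker (Br k → Br K)`. -/
def SplitsIn (k : Type*) [Field k] (A : Type*) [Ring A] [Algebra k A]
    (K : Type*) [CommRing K] [Algebra k K] : Prop :=
  ∃ n : ℕ, 0 < n ∧ Nonempty ((K ⊗[k] A) ≃ₐ[K] Matrix (Fin n) (Fin n) K)

/-- Brauer equivalence of two `k`-algebras. -/
def BrauerEquiv (k A B : Type*) [Field k] [Ring A] [Algebra k A] [Ring B] [Algebra k B] :
    Prop :=
  ∃ n m : ℕ, 0 < n ∧ 0 < m ∧
    Nonempty (Matrix (Fin n) (Fin n) A ≃ₐ[k] Matrix (Fin m) (Fin m) B)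

/-- A field is finitely generated (over its prime subfield). -/
def FieldFG (K : Type*) [Field K] : Prop :=
  ∃ s : Finset K, Subfield.closure (s : Set K) = ⊤

/-- Elementary equivalence in the first-order language of rings. -/
def ElemEquivRing (K₁ : Type*) (K₂ : Type*) [CommRing K₁] [CommRing K₂] : Prop :=
  letI := FirstOrder.Ring.compatibleRingOfRing K₁
  letI := FirstOrder.Ring.compatibleRingOfRing K₂
  FirstOrder.Language.ring.ElementarilyEquivalent K₁ K₂

/-- The `m`-fold Pfister form `⟨⟨a₁,…,aₘ⟩⟩ = ⟨1,a₁⟩ ⊗ ⋯ ⊗ ⟨1,aₘ⟩`. -/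
def pfisterForm {k : Type*} [Field k] {m : ℕ} (a : Fin m → k) :
    QuadraticForm k (Fin (2 ^ m) → k) :=
  QuadraticMap.weightedSumSquares k
    (fun j : Fin (2 ^ m) => ∏ i : Fin m, if Nat.testBit (j : ℕ) (i : ℕ) then a i else 1)

namespace QuadricIsogeny

section ConicRing
open Polynomial

variable {F : Type*} [Field F] {α β : F}

/-- The affine coordinate ring `F[X, Y] / (Y² - α X² - β)` of a conic. -/
abbrev ConicRing (α β : F) : Type _ := QuadraticAlgebra F[X] (C α * X ^ 2 + C β) 0

/-- The elements of the conic ring of degree at most `n`. -/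
def conicFilt (α β : F) (n : ℕ) : Submodule F (ConicRing α β) where
  carrier := {u | (∀ i, n < i → u.re.coeff i = 0) ∧ ∀ i, n ≤ i → u.im.coeff i = 0}
  zero_mem' := by simp
  add_mem' := by
    rintro u v ⟨hu, hu'⟩ ⟨hv, hv'⟩
    exact ⟨fun i hi => by simp [hu i hi, hv i hi], fun i hi => by simp [hu' i hi, hv' i hi]⟩
  smul_mem' := by
    rintro c u ⟨hu, hu'⟩
    exact ⟨fun i hi => by simp [hu i hi], fun i hi => by simp [hu' i hi]⟩

/-- The coefficient of the top degree part, in the residue field at infinity. -/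
def conicLead (n : ℕ) : ConicRing α β →ₗ[F] QuadraticAlgebra F α 0 where
  toFun u := ⟨u.re.coeff n, (X * u.im).coeff n⟩
  map_add' u v := by ext <;> simp [mul_add]
  map_smul' c u := by ext <;> simp

theorem mem_conicFilt {n : ℕ} {u : ConicRing α β} :
    u ∈ conicFilt α β n ↔ u.re.natDegree ≤ n ∧ (X * u.im).natDegree ≤ n := by
  rw [natDegree_le_iff_coeff_eq_zero, natDegree_le_iff_coeff_eq_zero]
  refine and_congr Iff.rfl ⟨fun h i hi => ?_, fun h i hi => ?_⟩
  · obtain ⟨j, rfl⟩ : ∃ j, i = j + 1 := ⟨i - 1, by omega⟩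
    rw [coeff_X_mul]; exact h j (by omega)
  · have := h (i + 1) (by omega)
    rwa [coeff_X_mul] at this

theorem conicFilt_mono {n m : ℕ} (h : n ≤ m) : conicFilt α β n ≤ conicFilt α β m :=
  fun _ hu => ⟨fun i hi => hu.1 i (by omega), fun i hi => hu.2 i (by omega)⟩

theorem conic_mul_mem {n m : ℕ} {u v : ConicRing α β} (hu : u ∈ conicFilt α β n)
    (hv : v ∈ conicFilt α β m) : u * v ∈ conicFilt α β (n + m) := by
  rw [mem_conicFilt] at *
  have h1 : (u.re * v.re).natDegree ≤ n + m := natDegree_mul_le_of_le hu.1 hv.1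
  have h2 : (X * u.im * (X * v.im)).natDegree ≤ n + m := natDegree_mul_le_of_le hu.2 hv.2
  have h3 : (u.re * (X * v.im)).natDegree ≤ n + m := natDegree_mul_le_of_le hu.1 hv.2
  have h4 : (X * u.im * v.re).natDegree ≤ n + m := natDegree_mul_le_of_le hu.2 hv.1
  have h5 : (u.im * v.im).natDegree ≤ n + m := by
    rw [natDegree_le_iff_coeff_eq_zero] at h2 ⊢
    intro i hi
    have := h2 (i + 1 + 1) (by omega)
    rwa [show X * u.im * (X * v.im) = X * (X * (u.im * v.im)) by ring, coeff_X_mul,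
      coeff_X_mul] at this
  constructor
  · have e : (u * v).re = u.re * v.re + C α * (X * u.im * (X * v.im)) + C β * (u.im * v.im) := by
      simp only [QuadraticAlgebra.re_mul]; ring
    rw [e]
    exact natDegree_add_le_of_degree_le (natDegree_add_le_of_degree_le h1
      ((natDegree_C_mul_le _ _).trans h2)) ((natDegree_C_mul_le _ _).trans h5)
  · have e : X * (u * v).im = u.re * (X * v.im) + X * u.im * v.re := by
      simp only [QuadraticAlgebra.im_mul]; ring
    rw [e]
    exact natDegree_add_le_of_degree_le h3 h4

theorem conicLead_mul {n m : ℕ} {u v : ConicRing α β} (hu : u ∈ conicFilt α β n)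
    (hv : v ∈ conicFilt α β m) :
    conicLead (n + m) (u * v) = conicLead n u * conicLead m v := by
  rw [mem_conicFilt] at *
  have h5 : (u.im * v.im).coeff (n + m) = 0 := by
    have h2 : (X * u.im * (X * v.im)).natDegree ≤ n + m := natDegree_mul_le_of_le hu.2 hv.2
    rw [natDegree_le_iff_coeff_eq_zero] at h2
    have := h2 (n + m + 1 + 1) (by omega)
    rwa [show X * u.im * (X * v.im) = X * (X * (u.im * v.im)) by ring, coeff_X_mul,
      coeff_X_mul] at this
  have e : (u * v).re = u.re * v.re + C α * (X * u.im * (X * v.im)) + C β * (u.im * v.im) := by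
    simp only [QuadraticAlgebra.re_mul]; ring
  have e' : X * (u * v).im = u.re * (X * v.im) + X * u.im * v.re := by
    simp only [QuadraticAlgebra.im_mul]; ring
  ext
  · simp only [conicLead, LinearMap.coe_mk, AddHom.coe_mk]
    rw [e]
    simp only [coeff_add, coeff_C_mul, h5, QuadraticAlgebra.re_mul]
    rw [coeff_mul_add_eq_of_natDegree_le hu.1 hv.1, coeff_mul_add_eq_of_natDegree_le hu.2 hv.2]
    ring
  · simp only [conicLead, LinearMap.coe_mk, AddHom.coe_mk]
    rw [e']
    simp only [coeff_add, QuadraticAlgebra.im_mul]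
    rw [coeff_mul_add_eq_of_natDegree_le hu.1 hv.2, coeff_mul_add_eq_of_natDegree_le hu.2 hv.1]
    ring

theorem mem_conicFilt_of_lead_eq_zero {n : ℕ} {u : ConicRing α β}
    (hu : u ∈ conicFilt α β (n + 1)) (h : conicLead (n + 1) u = 0) : u ∈ conicFilt α β n := by
  have h1 : u.re.coeff (n + 1) = 0 := congrArg QuadraticAlgebra.re h
  have h2 : (X * u.im).coeff (n + 1) = 0 := congrArg QuadraticAlgebra.im h
  rw [coeff_X_mul] at h2
  refine ⟨fun i hi => ?_, fun i hi => ?_⟩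
  · rcases eq_or_lt_of_le (Nat.succ_le_of_lt hi) with rfl | h'
    · exact h1
    · exact hu.1 i h'
  · rcases eq_or_lt_of_le hi with rfl | h'
    · exact h2
    · exact hu.2 i h'

theorem conicLead_eq_zero {n m : ℕ} (h : n < m) {u : ConicRing α β}
    (hu : u ∈ conicFilt α β n) : conicLead m u = 0 := by
  rw [mem_conicFilt, natDegree_le_iff_coeff_eq_zero, natDegree_le_iff_coeff_eq_zero] at hu
  ext
  · exact hu.1 m h
  · exact hu.2 m h

theorem exists_mem_conicFilt (u : ConicRing α β) : ∃ n, u ∈ conicFilt α β n :=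
  ⟨max u.re.natDegree (X * u.im).natDegree, mem_conicFilt.2 ⟨le_max_left _ _, le_max_right _ _⟩⟩

theorem conic_algebraMap_re (c : F) : (algebraMap F (ConicRing α β) c).re = C c := by
  rw [Algebra.algebraMap_eq_smul_one, QuadraticAlgebra.re_smul, QuadraticAlgebra.re_one,
    smul_eq_C_mul, mul_one]

theorem conic_algebraMap_im (c : F) : (algebraMap F (ConicRing α β) c).im = 0 := by
  rw [Algebra.algebraMap_eq_smul_one, QuadraticAlgebra.im_smul, QuadraticAlgebra.im_one, smul_zero]

theorem mem_conicFilt_zero {u : ConicRing α β} (hu : u ∈ conicFilt α β 0) :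
    ∃ c : F, u = algebraMap F _ c := by
  have him : u.im = 0 := by ext i; simpa using hu.2 i (Nat.zero_le _)
  refine ⟨u.re.coeff 0, ?_⟩
  ext1
  · rw [conic_algebraMap_re]; exact eq_C_of_natDegree_le_zero (mem_conicFilt.1 hu).1
  · rw [him, conic_algebraMap_im]

theorem exists_exact {u : ConicRing α β} (hu : u ≠ 0) :
    ∃ n, u ∈ conicFilt α β n ∧ conicLead n u ≠ 0 := by
  classical
  have hex := exists_mem_conicFilt u
  refine ⟨Nat.find hex, Nat.find_spec hex, fun h => ?_⟩
  have hs := Nat.find_spec hex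
  rcases hn : Nat.find hex with _ | n
  · rw [hn] at hs h
    apply hu
    obtain ⟨c, rfl⟩ := mem_conicFilt_zero hs
    have : c = 0 := by simpa [conicLead, conic_algebraMap_re] using congrArg QuadraticAlgebra.re h
    simp [this]
  · rw [hn] at hs h
    exact Nat.find_min hex (by omega) (mem_conicFilt_of_lead_eq_zero hs h)

theorem conicFilt_finrank (n : ℕ) : Module.finrank F (conicFilt α β n) = 2 * n + 1 ∧
    Module.Finite F (conicFilt α β n) := by
  let e : conicFilt α β n ≃ₗ[F] (degreeLT F (n + 1) × degreeLT F n) :=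
    { toFun := fun u => (⟨u.1.re, by
          rw [mem_degreeLT, degree_lt_iff_coeff_zero]; intro m hm; exact u.2.1 m (by omega)⟩,
        ⟨u.1.im, by
          rw [mem_degreeLT, degree_lt_iff_coeff_zero]; intro m hm; exact u.2.2 m (by omega)⟩)
      map_add' := fun u v => rfl
      map_smul' := fun c u => rfl
      invFun := fun p => ⟨⟨p.1.1, p.2.1⟩, by
        have h1 := p.1.2
        have h2 := p.2.2
        rw [mem_degreeLT, degree_lt_iff_coeff_zero] at h1 h2
        exact ⟨fun i hi => h1 i (by omega), fun i hi => h2 i (by omega)⟩⟩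
      left_inv := fun u => rfl
      right_inv := fun p => rfl }
  have f1 := Module.Finite.equiv (degreeLTEquiv F (n + 1)).symm
  have f2 := Module.Finite.equiv (degreeLTEquiv F n).symm
  refine ⟨?_, Module.Finite.equiv e.symm⟩
  rw [e.finrank_eq, Module.finrank_prod, (degreeLTEquiv F (n + 1)).finrank_eq,
    (degreeLTEquiv F n).finrank_eq]
  simp; omega

end ConicRing
section ConicRing
open Polynomial

variable {F : Type*} [Field F] {α β : F}

instance (n : ℕ) : Module.Finite F (conicFilt α β n) := (conicFilt_finrank n).2

theorem conicLead_mul_ne_zero (hα : ∀ r : F, r ^ 2 ≠ α) {n m : ℕ} {u v : ConicRing α β}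
    (hu : u ∈ conicFilt α β n) (hu' : conicLead n u ≠ 0)
    (hv : v ∈ conicFilt α β m) (hv' : conicLead m v ≠ 0) : conicLead (n + m) (u * v) ≠ 0 := by
  have : Fact (∀ r : F, r ^ 2 ≠ α + 0 * r) := ⟨by simpa using hα⟩
  rw [conicLead_mul hu hv]
  exact mul_ne_zero hu' hv'

theorem conic_mul_ne_zero (hα : ∀ r : F, r ^ 2 ≠ α) {u v : ConicRing α β} (hu : u ≠ 0)
    (hv : v ≠ 0) : u * v ≠ 0 := by
  obtain ⟨n, hn, hn'⟩ := exists_exact hu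
  obtain ⟨m, hm, hm'⟩ := exists_exact hv
  intro h
  apply conicLead_mul_ne_zero hα hn hn' hm hm'
  rw [h, map_zero]

theorem mem_conicFilt_of_mul_mem (hα : ∀ r : F, r ^ 2 ≠ α) {n m : ℕ} {s u : ConicRing α β}
    (hs : s ∈ conicFilt α β n) (hs' : conicLead n s ≠ 0) (h : s * u ∈ conicFilt α β (n + m)) :
    u ∈ conicFilt α β m := by
  by_cases hu : u = 0
  · rw [hu]; exact zero_mem _
  obtain ⟨m', hm, hm'⟩ := exists_exact hu
  by_contra hcon
  have hlt : m < m' := by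
    by_contra hle
    exact hcon (conicFilt_mono (by omega) hm)
  exact conicLead_mul_ne_zero hα hs hs' hm hm' (conicLead_eq_zero (by omega) h)

/-- Approximation: `v / s` is a quotient `(s h + r) / (s c)` with small remainder `r`. -/
theorem conic_approx (hα : ∀ r : F, r ^ 2 ≠ α) {n : ℕ} (hn : 2 ≤ n) {v : Fin 4 → ConicRing α β}
    (hv : ∀ i, v i ∈ conicFilt α β n) (i₀ : Fin 4) (hs : conicLead n (v i₀) ≠ 0)
    (l : ConicRing α β →ₗ[F] F) :
    ∃ (c : ConicRing α β) (h r : Fin 4 → ConicRing α β), c ≠ 0 ∧ c ∈ conicFilt α β n ∧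
      (∀ i, h i ∈ conicFilt α β n) ∧ (∀ i, r i ∈ conicFilt α β (n - 1)) ∧ r i₀ = 0 ∧
      (∀ i, c * v i = v i₀ * h i + r i) ∧ l c = 0 := by
  classical
  let J := {i : Fin 4 // i ≠ i₀}
  let Φ : (conicFilt α β n × (J → conicFilt α β n) × (J → conicFilt α β (n - 1))) →ₗ[F]
      ((J → conicFilt α β (n + n)) × F) :=
    { toFun := fun p => (fun i => ⟨p.1.1 * v i.1 - v i₀ * (p.2.1 i).1 - (p.2.2 i).1,
          sub_mem (sub_mem (conic_mul_mem p.1.2 (hv _)) (conic_mul_mem (hv _) (p.2.1 i).2))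
            (conicFilt_mono (by omega) (p.2.2 i).2)⟩, l p.1.1)
      map_add' := fun p p' => by
        ext1
        · funext i
          ext1
          simp only [Prod.fst_add, Prod.snd_add, Pi.add_apply, Submodule.coe_add]
          ring
        · simp
      map_smul' := fun c p => by
        ext1
        · funext i
          ext1
          simp [smul_sub]
        · simp }
  have hJ : Fintype.card J = 3 := by
    simp [J]
  have hker : LinearMap.ker Φ ≠ ⊥ := by
    apply LinearMap.ker_ne_bot_of_finrank_lt
    simp only [Module.finrank_prod, Module.finrank_pi_fintype, (conicFilt_finrank _).1,
      Finset.sum_const, Finset.card_univ, hJ, Module.finrank_self, smul_eq_mul]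
    omega
  obtain ⟨⟨c, h, r⟩, hp, hp0⟩ := (Submodule.ne_bot_iff _).1 hker
  rw [LinearMap.mem_ker] at hp
  have hp1 : ∀ i : J, c.1 * v i.1 - v i₀ * (h i).1 - (r i).1 = 0 := fun i =>
    congrArg Subtype.val (congrFun (congrArg Prod.fst hp) i)
  have hp2 : l c.1 = 0 := congrArg Prod.snd hp
  have hc : c.1 ≠ 0 := by
    intro hc
    apply hp0
    have hh : ∀ i, (h i).1 = 0 := by
      intro i
      by_contra hne
      obtain ⟨m, hm, hm'⟩ := exists_exact hne
      have h1 := conicLead_mul_ne_zero hα (hv i₀) hs hm hm'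
      apply h1
      have h2 := hp1 i
      rw [hc, zero_mul, zero_sub, sub_eq_zero] at h2
      have h3 : v i₀ * (h i).1 ∈ conicFilt α β (n - 1) := by
        rw [← neg_mem_iff, h2]; exact (r i).2
      exact conicLead_eq_zero (by omega) h3
    have hr : ∀ i, (r i).1 = 0 := by
      intro i
      have h2 := hp1 i
      rw [hc, hh i] at h2
      simpa using h2
    ext1
    · exact Subtype.ext hc
    · ext1
      · funext i; exact Subtype.ext (hh i)
      · funext i; exact Subtype.ext (hr i)
  refine ⟨c.1, fun i => if hi : i ≠ i₀ then (h ⟨i, hi⟩).1 else c.1,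
    fun i => if hi : i ≠ i₀ then (r ⟨i, hi⟩).1 else 0, hc, c.2, fun i => ?_, fun i => ?_, ?_,
    fun i => ?_, hp2⟩
  · dsimp only; split_ifs
    · exact (h _).2
    · exact c.2
  · dsimp only; split_ifs
    · exact (r _).2
    · exact zero_mem _
  · simp
  · by_cases hi : i = i₀
    · subst hi; simp [mul_comm]
    · have := hp1 ⟨i, hi⟩
      simp only [ne_eq, hi, not_false_eq_true, dite_true]
      linear_combination this

/-- Reflecting an isotropic vector. -/
theorem reflection_identities {R : Type*} [CommRing R] {b v h r w : Fin 4 → R} {s c : R}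
    (hv : ∑ i, b i * v i ^ 2 = 0) (hcv : ∀ i, c * v i = s * h i + r i)
    (hw : ∀ i, w i = (∑ j, b j * h j ^ 2) * v i - 2 * (∑ j, b j * v j * h j) * h i) :
    (∑ i, b i * w i ^ 2 = 0) ∧
    ∀ i, s * s * w i = (∑ j, b j * r j ^ 2) * v i - 2 * (∑ j, b j * v j * r j) * r i := by
  constructor
  · simp only [hw]
    simp only [Fin.sum_univ_four] at hv ⊢
    linear_combination (b 0 * h 0 ^ 2 + b 1 * h 1 ^ 2 + b 2 * h 2 ^ 2 + b 3 * h 3 ^ 2) ^ 2 * hv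
  · intro i
    have hr : ∀ i, r i = c * v i - s * h i := fun i => by linear_combination - hcv i
    simp only [hr, hw]
    simp only [Fin.sum_univ_four] at hv ⊢
    linear_combination (c ^ 2 * v i - 2 * c * s * h i) * hv

end ConicRing
section ConicRing
open Polynomial

variable {F : Type*} [Field F] {α β : F}

theorem exists_conicLead_eq (e : QuadraticAlgebra F α 0) :
    ∃ u ∈ conicFilt α β 1, conicLead 1 u = e := by
  refine ⟨⟨C e.re * X, C e.im⟩, mem_conicFilt.2
    ⟨natDegree_C_mul_le _ _ |>.trans natDegree_X_le, ?_⟩, ?_⟩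
  · rw [mul_comm]; exact (natDegree_C_mul_le _ _).trans natDegree_X_le
  · ext <;> simp [conicLead]

theorem exists_isotropic_lt (hα : ∀ r : F, r ^ 2 ≠ α)
    (hαβ : ∀ x y : F, y ^ 2 ≠ α * x ^ 2 + β) (b : Fin 4 → F) {n : ℕ} (hn : 2 ≤ n)
    {v : Fin 4 → ConicRing α β} (hv : ∀ i, v i ∈ conicFilt α β n) (hv0 : v ≠ 0)
    (hvb : ∑ i, algebraMap F _ (b i) * v i ^ 2 = 0) :
    ∃ m < n, ∃ w : Fin 4 → ConicRing α β, (∀ i, w i ∈ conicFilt α β m) ∧ w ≠ 0 ∧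
      ∑ i, algebraMap F _ (b i) * w i ^ 2 = 0 := by
  by_contra! hmin
  obtain ⟨n, rfl⟩ : ∃ n', n = n' + 1 := ⟨n - 1, by omega⟩
  have hmin' : ∀ w : Fin 4 → ConicRing α β, (∀ i, w i ∈ conicFilt α β n) →
      ∑ i, algebraMap F _ (b i) * w i ^ 2 = 0 → w = 0 := fun w hw hwb => by
    by_contra hw0
    exact hmin n (by omega) w hw hw0 hwb
  obtain ⟨i₀, hi₀⟩ : ∃ i, conicLead (n + 1) (v i) ≠ 0 := by
    by_contra! hcon
    exact hv0 (hmin' v (fun i => mem_conicFilt_of_lead_eq_zero (hv i) (hcon i)) hvb)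
  obtain ⟨s, hs⟩ : ∃ s, s = v i₀ := ⟨_, rfl⟩
  have hsn : s ∈ conicFilt α β (n + 1) := hs ▸ hv i₀
  rw [← hs] at hi₀
  have hs0 : s ≠ 0 := by rintro rfl; simp at hi₀
  -- a coordinate of the leading coefficient not vanishing on `s`
  obtain ⟨l, hl, hls⟩ : ∃ l : QuadraticAlgebra F α 0 →ₗ[F] F,
      (∀ e d, l e ≠ 0 → l d = 0 → d ≠ 0 → ∀ f, ∃ x y : F, f = x • d + y • e) ∧
      l (conicLead (n + 1) s) ≠ 0 := by
    by_cases hre : (conicLead (n + 1) s).re = 0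
    · refine ⟨⟨⟨fun e => e.im, fun _ _ => rfl⟩, fun _ _ => rfl⟩, ?_, fun h => ?_⟩
      · intro e d (he : e.im ≠ 0) (hd : d.im = 0) hd0 f
        have hd1 : d.re ≠ 0 := fun h => hd0 (by ext <;> simp [h, hd])
        refine ⟨(f.re - f.im / e.im * e.re) / d.re, f.im / e.im, ?_⟩
        ext <;> simp [hd] <;> field_simp
        ring
      · exact hi₀ (by ext; exacts [hre, h])
    · refine ⟨⟨⟨fun e => e.re, fun _ _ => rfl⟩, fun _ _ => rfl⟩, ?_, hre⟩
      · intro e d (he : e.re ≠ 0) (hd : d.re = 0) hd0 f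
        have hd1 : d.im ≠ 0 := fun h => hd0 (by ext <;> simp [h, hd])
        refine ⟨(f.im - f.re / e.re * e.im) / d.im, f.re / e.re, ?_⟩
        ext <;> simp [hd] <;> field_simp
        ring
  obtain ⟨c, h, r, hc0, hc, hh, hr, hri₀, hcv, hlc⟩ := conic_approx hα hn hv i₀ (hs ▸ hi₀)
    (l ∘ₗ conicLead (n + 1))
  simp only [LinearMap.comp_apply, ← hs] at hlc hcv
  by_cases hr0 : r = 0
  · -- the ideal of denominators
    have hI : ∀ c' ∈ conicFilt α β n, (∀ i, s ∣ c' * v i) → c' = 0 := by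
      intro c' hc' hdvd
      choose g hg using hdvd
      have hgn : ∀ i, g i ∈ conicFilt α β n := fun i => by
        apply mem_conicFilt_of_mul_mem hα hsn hi₀
        rw [← hg, mul_comm c']
        exact conic_mul_mem (hv i) hc'
      have hgb : ∑ i, algebraMap F _ (b i) * g i ^ 2 = 0 := by
        by_contra hne
        apply conic_mul_ne_zero hα (conic_mul_ne_zero hα hs0 hs0) hne
        have : s * s * ∑ i, algebraMap F _ (b i) * g i ^ 2 =
            c' ^ 2 * ∑ i, algebraMap F _ (b i) * v i ^ 2 := by
          rw [Finset.mul_sum, Finset.mul_sum]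
          refine Finset.sum_congr rfl fun i _ => ?_
          linear_combination - algebraMap F _ (b i) * (s * g i + c' * v i) * hg i
        rw [this, hvb, mul_zero]
      have hg0 := hmin' g hgn hgb
      by_contra hc'0
      apply conic_mul_ne_zero hα hc'0 hs0
      have := hg i₀
      rw [← hs, hg0] at this
      simpa using this
    have hcI : ∀ i, s ∣ c * v i := fun i => ⟨h i, by rw [hcv, hr0]; simp⟩
    have hlc0 : conicLead (n + 1) c ≠ 0 := fun h0 =>
      hc0 (hI c (mem_conicFilt_of_lead_eq_zero hc h0) hcI)
    have hspan : ∀ u ∈ conicFilt α β (n + 1), (∀ i, s ∣ u * v i) →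
        ∃ x y : F, u = x • c + y • s := by
      intro u hu hui
      obtain ⟨x, y, hxy⟩ := hl _ _ hls hlc hlc0 (conicLead (n + 1) u)
      refine ⟨x, y, ?_⟩
      rw [← sub_eq_zero]
      apply hI
      · apply mem_conicFilt_of_lead_eq_zero
        · exact sub_mem hu (add_mem (Submodule.smul_mem _ _ hc) (Submodule.smul_mem _ _ hsn))
        · rw [map_sub, map_add, map_smul, map_smul, ← hxy, sub_self]
      · intro i
        rw [sub_mul, add_mul, smul_mul_assoc, smul_mul_assoc]
        exact dvd_sub (hui i) (dvd_add ((hcI i).trans ⟨algebraMap F _ x, by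
          rw [Algebra.smul_def, mul_comm]⟩) ⟨y • v i, by rw [mul_smul_comm]⟩)
    have hmul : ∀ z ∈ conicFilt α β 1, ∃ (x : F) (t : ConicRing α β), z * c = x • c + s * t := by
      intro z hz
      have : Fact (∀ r : F, r ^ 2 ≠ α + 0 * r) := ⟨by simpa using hα⟩
      obtain ⟨t, ht, ht'⟩ := exists_conicLead_eq (β := β) (conicLead 1 z * conicLead (n + 1) c /
        conicLead (n + 1) s)
      obtain ⟨x, y, hxy⟩ := hspan (z * c - s * t) (by
        apply mem_conicFilt_of_lead_eq_zero
        · apply sub_mem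
          · rw [mul_comm z]; exact conic_mul_mem hc hz
          · exact conic_mul_mem hsn ht
        · rw [map_sub, conicLead_mul hsn ht, ht', add_comm (n + 1), conicLead_mul hz hc]
          field_simp
          simp) (fun i => by
        rw [sub_mul]
        apply dvd_sub
        · rw [mul_assoc]; exact (hcI i).mul_left _
        · rw [mul_assoc]; exact dvd_mul_right _ _)
      refine ⟨x, t + algebraMap F _ y, ?_⟩
      rw [Algebra.smul_def] at hxy ⊢
      rw [Algebra.smul_def] at hxy
      linear_combination hxy
    obtain ⟨x, t, hx⟩ := hmul ⟨X, 0⟩ (mem_conicFilt.2 ⟨by simp, by simp⟩)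
    obtain ⟨y, t', hy⟩ := hmul ⟨0, 1⟩ (mem_conicFilt.2 ⟨by simp, by simp⟩)
    have hXY : (⟨0, 1⟩ : ConicRing α β) ^ 2 =
        algebraMap F _ α * (⟨X, 0⟩ : ConicRing α β) ^ 2 + algebraMap F _ β := by
      ext1 <;> simp [pow_two, conic_algebraMap_re, conic_algebraMap_im]
    generalize (⟨0, 1⟩ : ConicRing α β) = Y at *
    generalize (⟨X, 0⟩ : ConicRing α β) = X' at *
    have hκ : y ^ 2 - α * x ^ 2 - β ≠ 0 := fun h0 => hαβ x y (by linear_combination h0)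
    rw [Algebra.smul_def] at hx hy
    have hdvd : algebraMap F _ (y ^ 2 - α * x ^ 2 - β) * c =
        s * (algebraMap F _ α * (X' * t + algebraMap F _ x * t) -
          (Y * t' + algebraMap F _ y * t')) := by
      simp only [map_sub, map_mul, map_pow]
      linear_combination (-Y - algebraMap F _ y) * hy + c * hXY +
        algebraMap F _ α * (X' + algebraMap F _ x) * hx
    obtain ⟨t₀, ht₀⟩ : ∃ t₀, c = s * t₀ := by
      refine ⟨algebraMap F _ (y ^ 2 - α * x ^ 2 - β)⁻¹ *
        (algebraMap F _ α * (X' * t + algebraMap F _ x * t) -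
          (Y * t' + algebraMap F _ y * t')), ?_⟩
      rw [mul_left_comm, ← hdvd, ← mul_assoc, ← map_mul, inv_mul_cancel₀ hκ, map_one, one_mul]
    have ht₀' : t₀ ∈ conicFilt α β 0 := by
      apply mem_conicFilt_of_mul_mem hα hsn hi₀
      rw [← ht₀]; exact hc
    obtain ⟨d, rfl⟩ := mem_conicFilt_zero ht₀'
    rw [mul_comm, ← Algebra.smul_def] at ht₀
    rw [ht₀, map_smul, map_smul, smul_eq_mul, mul_eq_zero, or_iff_left hls] at hlc
    rw [hlc, zero_smul] at ht₀
    exact hc0 ht₀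
  · -- a smaller isotropic vector by reflection
    have hφr : ∑ j, algebraMap F _ (b j) * r j ^ 2 ≠ 0 := fun h0 => hr0 (hmin' r hr h0)
    obtain ⟨n, rfl⟩ : ∃ n', n = n' + 1 := ⟨n - 1, by omega⟩
    have hconst : ∀ (x : F) {m} {u : ConicRing α β}, u ∈ conicFilt α β m →
        algebraMap F _ x * u ∈ conicFilt α β m := fun x m u hu => by
      rw [← Algebra.smul_def]; exact Submodule.smul_mem _ _ hu
    obtain ⟨w, hw⟩ : ∃ w : Fin 4 → ConicRing α β, ∀ i,
        w i = (∑ j, algebraMap F _ (b j) * h j ^ 2) * v i -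
          2 * (∑ j, algebraMap F _ (b j) * v j * h j) * h i := ⟨_, fun _ => rfl⟩
    obtain ⟨hwb, hsw⟩ := reflection_identities hvb hcv hw
    refine hmin n (by omega) w (fun i => ?_) ?_ hwb
    · apply mem_conicFilt_of_mul_mem hα (conic_mul_mem hsn hsn)
        (conicLead_mul_ne_zero hα hsn hi₀ hsn hi₀)
      rw [hsw]
      apply sub_mem
      · rw [show n + 1 + 1 + (n + 1 + 1) + n = (n + 1) + (n + 1) + (n + 1 + 1) by ring]
        refine conic_mul_mem (sum_mem fun j _ => hconst _ ?_) (hv i)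
        rw [pow_two (r j)]
        exact conic_mul_mem (hr j) (hr j)
      · rw [show n + 1 + 1 + (n + 1 + 1) + n = (n + 1 + 1) + (n + 1) + (n + 1) by ring]
        refine conic_mul_mem ?_ (hr i)
        rw [show (2 : ConicRing α β) = algebraMap F _ 2 from (map_ofNat _ 2).symm]
        refine hconst _ (sum_mem fun j _ => ?_)
        rw [mul_assoc]
        exact hconst _ (conic_mul_mem (hv j) (hr j))
    · intro hw0
      have h1 := hsw i₀
      rw [hri₀, mul_zero, sub_zero, ← hs] at h1
      apply conic_mul_ne_zero hα hφr hs0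
      rw [← h1]
      rw [hw0, Pi.zero_apply, mul_zero]
end ConicRing

/-- The diagonal quaternary form `⟨b₀, b₁, b₂, b₃⟩` is anisotropic over the ring `R`. -/
def DiagAniso {R : Type*} [CommRing R] (b : Fin 4 → R) : Prop :=
  ∀ x : Fin 4 → R, ∑ i, b i * x i ^ 2 = 0 → x = 0

section ConicRing
open Polynomial

variable {F : Type*} [Field F] {α β : F}

theorem exists_orthogonal_triple (h2 : (2 : F) ≠ 0) (hα : ∀ r : F, r ^ 2 ≠ α)
    (hαβ : ∀ x y : F, y ^ 2 ≠ α * x ^ 2 + β) {b : Fin 4 → F} (hb : DiagAniso b)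
    {A B : Fin 4 → F[X]} (hAB : A ≠ 0 ∨ B ≠ 0)
    (h1 : ∑ i, C (b i) * A i ^ 2 + (C α * X ^ 2 + C β) * ∑ i, C (b i) * B i ^ 2 = 0)
    (h3 : ∑ i, C (b i) * A i * B i = 0) :
    ∃ (u : Fin 3 → Fin 4 → F) (c : F), c ≠ 0 ∧ (∑ i, b i * u 0 i ^ 2 = c) ∧
      (∑ i, b i * u 1 i ^ 2 = -α * c) ∧ (∑ i, b i * u 2 i ^ 2 = -β * c) ∧
      (∑ i, b i * u 0 i * u 1 i = 0) ∧ (∑ i, b i * u 0 i * u 2 i = 0) ∧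
      ∑ i, b i * u 1 i * u 2 i = 0 := by
  classical
  have key : ∀ v : Fin 4 → ConicRing α β, ∑ i, algebraMap F _ (b i) * v i ^ 2 = 0 ↔
      (∑ i, C (b i) * (v i).re ^ 2 + (C α * X ^ 2 + C β) * ∑ i, C (b i) * (v i).im ^ 2 = 0) ∧
      2 * ∑ i, C (b i) * (v i).re * (v i).im = 0 := by
    intro v
    rw [QuadraticAlgebra.ext_iff]
    simp only [Fin.sum_univ_four, pow_two, QuadraticAlgebra.re_add, QuadraticAlgebra.im_add,
      QuadraticAlgebra.re_mul, QuadraticAlgebra.im_mul, conic_algebraMap_re, conic_algebraMap_im,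
      QuadraticAlgebra.re_zero, QuadraticAlgebra.im_zero]
    refine and_congr (Eq.congr ?_ rfl) (Eq.congr ?_ rfl) <;> ring
  have hex : ∃ n, ∃ w : Fin 4 → ConicRing α β, (∀ i, w i ∈ conicFilt α β n) ∧ w ≠ 0 ∧
      ∑ i, algebraMap F _ (b i) * w i ^ 2 = 0 := by
    have hmem := fun i => exists_mem_conicFilt (⟨A i, B i⟩ : ConicRing α β)
    choose m hm using hmem
    refine ⟨∑ i, m i, fun i => ⟨A i, B i⟩, fun i => conicFilt_mono ?_ (hm i), fun h0 => ?_, ?_⟩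
    · exact Finset.single_le_sum (f := m) (fun _ _ => Nat.zero_le _) (Finset.mem_univ i)
    · rcases hAB with hA | hB
      · exact hA (funext fun i => congrArg QuadraticAlgebra.re (congrFun h0 i))
      · exact hB (funext fun i => congrArg QuadraticAlgebra.im (congrFun h0 i))
    · rw [key]
      exact ⟨h1, by rw [h3, mul_zero]⟩
  have hlt : Nat.find hex < 2 := by
    by_contra hge
    obtain ⟨w, hw, hw0, hwb⟩ := Nat.find_spec hex
    obtain ⟨m, hm, hm'⟩ := exists_isotropic_lt hα hαβ b (by omega) hw hw0 hwb
    exact Nat.find_min hex hm hm'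
  obtain ⟨w, hw, hw0, hwb⟩ := Nat.find_spec hex
  replace hw : ∀ i, w i ∈ conicFilt α β 1 := fun i => conicFilt_mono (by omega) (hw i)
  have hre : ∀ i, (w i).re = C ((w i).re.coeff 1) * X + C ((w i).re.coeff 0) := fun i =>
    eq_X_add_C_of_natDegree_le_one (mem_conicFilt.1 (hw i)).1
  have him : ∀ i, (w i).im = C ((w i).im.coeff 0) := fun i => by
    apply eq_C_of_natDegree_le_zero
    rw [natDegree_le_iff_coeff_eq_zero]
    exact fun j hj => (hw i).2 j (by omega)
  obtain ⟨e1, e2⟩ := (key w).1 hwb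
  generalize hp : (fun i => (w i).re.coeff 0) = p at *
  generalize hq : (fun i => (w i).re.coeff 1) = q at *
  generalize hr : (fun i => (w i).im.coeff 0) = r at *
  have hre' : ∀ i, (w i).re = C (q i) * X + C (p i) := fun i => by rw [hre, ← hp, ← hq]
  have him' : ∀ i, (w i).im = C (r i) := fun i => by rw [him, ← hr]
  simp only [hre', him'] at e1 e2
  have e1' : C (∑ i, b i * q i ^ 2 + α * ∑ i, b i * r i ^ 2) * X ^ 2 +
      C (2 * ∑ i, b i * p i * q i) * X +
      C (∑ i, b i * p i ^ 2 + β * ∑ i, b i * r i ^ 2) = 0 := by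
    rw [← e1]
    simp only [Fin.sum_univ_four, map_add, map_mul, map_pow, map_ofNat]
    ring
  have e2' : C (2 * ∑ i, b i * q i * r i) * X + C (2 * ∑ i, b i * p i * r i) = 0 := by
    rw [← e2]
    simp only [Fin.sum_univ_four, map_add, map_mul, map_ofNat]
    ring
  have f1 := congrArg (coeff · 2) e1'
  have f2 := congrArg (coeff · 1) e1'
  have f3 := congrArg (coeff · 0) e1'
  have f4 := congrArg (coeff · 1) e2'
  have f5 := congrArg (coeff · 0) e2'
  simp [-map_add, -map_mul, -map_sum, coeff_X, coeff_C, h2] at f1 f2 f3 f4 f5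
  refine ⟨![r, q, p], ∑ i, b i * r i ^ 2, fun hc => ?_, rfl, ?_, ?_, ?_, ?_, ?_⟩
  · rw [hc, mul_zero, add_zero] at f1 f3
    have hr0 := hb r hc
    have hq0 := hb q f1
    have hp0 := hb p f3
    apply hw0
    funext i
    ext1
    · rw [hre', hq0, hp0]; simp
    · rw [him', hr0]; simp
  · simp only [Matrix.cons_val]; linear_combination f1
  · simp only [Matrix.cons_val]; linear_combination f3
  · simp only [Matrix.cons_val]; rw [← f4]; exact Finset.sum_congr rfl fun _ _ => by ring
  · simp only [Matrix.cons_val]; rw [← f5]; exact Finset.sum_congr rfl fun _ _ => by ring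
  · simp only [Matrix.cons_val]; rw [← f2]; exact Finset.sum_congr rfl fun _ _ => by ring

end ConicRing

section Gram
open Matrix

theorem gram_apply {R : Type*} [CommRing R] (b : Fin 4 → R) (U : Matrix (Fin 4) (Fin 4) R)
    (i j : Fin 4) : (U * diagonal b * Uᵀ) i j = ∑ l, b l * U i l * U j l := by
  rw [Matrix.mul_apply]
  refine Finset.sum_congr rfl fun l _ => ?_
  rw [Matrix.mul_diagonal, Matrix.transpose_apply]
  ring

theorem gram_det {R : Type*} [CommRing R] {b d : Fin 4 → R} {U : Matrix (Fin 4) (Fin 4) R}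
    (h : U * diagonal b * Uᵀ = diagonal d) : U.det ^ 2 * ∏ i, b i = ∏ i, d i := by
  have := congrArg det h
  rw [det_mul, det_mul, det_transpose, det_diagonal, det_diagonal] at this
  linear_combination this

variable {F : Type*} [Field F]

/-- An orthogonal triple completes to an orthogonal basis whose last value is normalised
by the discriminant. -/
theorem exists_gram_of_triple {a₀ a₁ g c : F} (ha₀ : a₀ ≠ 0) (ha₁ : a₁ ≠ 0) (hg : g ≠ 0)
    (hc : c ≠ 0) {b : Fin 4 → F} (hb : DiagAniso b) (u : Fin 3 → Fin 4 → F)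
    (h0 : ∑ i, b i * u 0 i ^ 2 = c * a₀) (h1 : ∑ i, b i * u 1 i ^ 2 = c * a₁)
    (h2 : ∑ i, b i * u 2 i ^ 2 = c * g) (h01 : ∑ i, b i * u 0 i * u 1 i = 0)
    (h02 : ∑ i, b i * u 0 i * u 2 i = 0) (h12 : ∑ i, b i * u 1 i * u 2 i = 0) :
    ∃ U : Matrix (Fin 4) (Fin 4) F, U * diagonal b * Uᵀ =
      diagonal ![c * a₀, c * a₁, c * g, c * (g * (a₀ * a₁ * ∏ i, b i))] := by
  obtain ⟨x, hx, hx0⟩ : ∃ x : Fin 4 → F, (∀ j, ∑ i, b i * u j i * x i = 0) ∧ x ≠ 0 := by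
    let Φ : (Fin 4 → F) →ₗ[F] (Fin 3 → F) :=
      (Matrix.of fun j i => b i * u j i : Matrix (Fin 3) (Fin 4) F).mulVecLin
    have hker : LinearMap.ker Φ ≠ ⊥ := LinearMap.ker_ne_bot_of_finrank_lt (by simp)
    obtain ⟨x, hx, hx0⟩ := (Submodule.ne_bot_iff _).1 hker
    exact ⟨x, fun j => congrFun hx j, hx0⟩
  obtain ⟨N, hN⟩ : ∃ N, N = ∑ i, b i * x i ^ 2 := ⟨_, rfl⟩
  have hN0 : N ≠ 0 := fun h => hx0 (hb x (hN ▸ h))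
  have hgram : ∀ t : F, (Matrix.of ![u 0, u 1, u 2, t • x]) * diagonal b *
      (Matrix.of ![u 0, u 1, u 2, t • x])ᵀ = diagonal ![c * a₀, c * a₁, c * g, t ^ 2 * N] := by
    intro t
    have hx0 := hx 0
    have hx1 := hx 1
    have hx2 := hx 2
    ext i j
    rw [gram_apply]
    simp only [Fin.sum_univ_four] at *
    fin_cases i <;> fin_cases j <;> simp [diagonal]
    · linear_combination h0
    · linear_combination h01
    · linear_combination h02
    · linear_combination t * hx0
    · linear_combination h01
    · linear_combination h1
    · linear_combination h12
    · linear_combination t * hx1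
    · linear_combination h02
    · linear_combination h12
    · linear_combination h2
    · linear_combination t * hx2
    · linear_combination t * hx0
    · linear_combination t * hx1
    · linear_combination t * hx2
    · linear_combination - t ^ 2 * hN
  have hdet := gram_det (hgram 1)
  rw [Fin.prod_univ_four (![c * a₀, c * a₁, c * g, 1 ^ 2 * N])] at hdet
  simp only [Matrix.cons_val] at hdet
  generalize det (Matrix.of ![u 0, u 1, u 2, (1 : F) • x]) = d at hdet
  have hd : d ≠ 0 := by
    rintro rfl
    have : c * a₀ * (c * a₁) * (c * g) * (1 ^ 2 * N) ≠ 0 := by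
      simp [hc, ha₀, ha₁, hg, hN0]
    apply this
    rw [← hdet]; ring
  refine ⟨_, (hgram (c ^ 2 * g * (a₀ * a₁) / d)).trans ?_⟩
  congr 5
  field_simp
  linear_combination - hdet

end Gram

section Lattice
open Matrix

theorem diagonal_fin_four_mul {R : Type*} [CommRing R] (Y : Matrix (Fin 4) (Fin 4) R)
    (t d : Fin 4 → R) : (Y * diagonal t) * diagonal d * (Y * diagonal t)ᵀ =
      Y * diagonal (fun i => t i ^ 2 * d i) * Yᵀ := by
  rw [transpose_mul, diagonal_transpose, ← Matrix.mul_assoc, Matrix.mul_assoc Y,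
    diagonal_mul_diagonal, Matrix.mul_assoc Y, diagonal_mul_diagonal]
  congr 3
  funext i; ring

variable {S : Type*} [CommRing S] [IsDomain S]

/-- Clearing denominators in a similarity between diagonal forms. -/
theorem exists_integral_gram {F : Type*} [Field F] [Algebra S F] [IsFractionRing S F]
    {b d : Fin 4 → S} {U : Matrix (Fin 4) (Fin 4) F} {c : F} (hc : c ≠ 0)
    (h : U * diagonal (fun i => algebraMap S F (b i)) * Uᵀ =
      diagonal fun i => c * algebraMap S F (d i)) :
    ∃ (Y : Matrix (Fin 4) (Fin 4) S) (e : S), e ≠ 0 ∧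
      Y * diagonal b * Yᵀ = diagonal fun i => e * d i := by
  obtain ⟨s, hs⟩ := IsLocalization.exist_integer_multiples_of_finite (nonZeroDivisors S)
    (fun p : Fin 4 × Fin 4 => U p.1 p.2)
  choose y hy using hs
  obtain ⟨n, m, hm, rfl⟩ := IsFractionRing.div_surjective (A := S) c
  have hm0 : algebraMap S F m ≠ 0 := by
    simpa using nonZeroDivisors.ne_zero hm
  have hn0 : n ≠ 0 := by
    rintro rfl; simp at hc
  refine ⟨Matrix.of fun i j => m * y (i, j), s ^ 2 * m * n, ?_, ?_⟩
  · exact mul_ne_zero (mul_ne_zero (pow_ne_zero _ (nonZeroDivisors.ne_zero s.2))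
      (nonZeroDivisors.ne_zero hm)) hn0
  · ext i j
    have hij := congrFun (congrFun h i) j
    rw [gram_apply] at hij ⊢
    apply IsFractionRing.injective S F
    have hy' : ∀ i j, algebraMap S F (y (i, j)) = algebraMap S F s * U i j := fun i j => by
      rw [hy, Algebra.smul_def]
    simp only [Matrix.of_apply, map_sum, map_mul, hy']
    have e1 : ∀ l, algebraMap S F (b l) * (algebraMap S F m * (algebraMap S F s * U i l)) *
        (algebraMap S F m * (algebraMap S F s * U j l)) =
        (algebraMap S F m * algebraMap S F s) ^ 2 * (algebraMap S F (b l) * U i l * U j l) :=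
      fun l => by ring
    simp only [e1]
    rw [← Finset.mul_sum, hij]
    by_cases hij' : i = j
    · subst hij'
      simp only [diagonal_apply_eq, map_mul, map_pow]
      field_simp
    · simp [diagonal_apply_ne _ hij']

/-- A binary form which is anisotropic modulo `g`. -/
def PairAniso (g p r : S) : Prop := ∀ y w : S, g ∣ p * y ^ 2 + r * w ^ 2 → g ∣ y ∧ g ∣ w

theorem no_lattice_of_pairAniso {g : S} (hg : Prime g) {b : Fin 4 → S} (hb : ∀ i, ¬ g ∣ b i)
    {c p₀ p₁ r₀ r₁ : S} (hc : ¬ g ∣ c) (hp : PairAniso g p₀ p₁) (hr : PairAniso g r₀ r₁)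
    {s₀ : S} (hs₀ : ¬ g ∣ s₀) (n : ℕ) (Y : Matrix (Fin 4) (Fin 4) S)
    (h : Y * diagonal ![c * p₀, c * p₁, c * (g * r₀), c * (g * r₁)] * Yᵀ =
      diagonal fun i => (g ^ n * s₀) ^ 2 * b i) : False := by
  induction n generalizing Y with
  | zero =>
    have hdet := gram_det h
    rw [Fin.prod_univ_four, Fin.prod_univ_four] at hdet
    simp only [Matrix.cons_val] at hdet
    have : g ∣ (g ^ 0 * s₀) ^ 2 * b 0 * ((g ^ 0 * s₀) ^ 2 * b 1) * ((g ^ 0 * s₀) ^ 2 * b 2) *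
        ((g ^ 0 * s₀) ^ 2 * b 3) := by
      rw [← hdet]
      exact ⟨Y.det ^ 2 * (c * p₀ * (c * p₁) * (c * r₀) * (c * (g * r₁))), by ring⟩
    simp only [pow_zero, one_mul] at this
    have hk : ∀ i, ¬ g ∣ s₀ ^ 2 * b i := fun i hi => by
      rcases hg.dvd_or_dvd hi with h' | h'
      · exact hs₀ (hg.dvd_of_dvd_pow h')
      · exact hb i h'
    rcases hg.dvd_or_dvd this with h' | h'
    · rcases hg.dvd_or_dvd h' with h' | h'
      · rcases hg.dvd_or_dvd h' with h' | h'
        · exact hk _ h'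
        · exact hk _ h'
      · exact hk _ h'
    · exact hk _ h'
  | succ n ih =>
    have hentry : ∀ i, c * (p₀ * Y i 0 ^ 2 + p₁ * Y i 1 ^ 2) +
        c * g * (r₀ * Y i 2 ^ 2 + r₁ * Y i 3 ^ 2) = (g ^ (n + 1) * s₀) ^ 2 * b i := fun i => by
      have := congrFun (congrFun h i) i
      rw [gram_apply, diagonal_apply_eq, Fin.sum_univ_four] at this
      simp only [Matrix.cons_val] at this
      linear_combination this
    have h01 : ∀ i, g ∣ Y i 0 ∧ g ∣ Y i 1 := fun i => by
      apply hp
      refine (hg.dvd_or_dvd ?_).resolve_left hc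
      refine ⟨g ^ (n + 1) * s₀ * (g ^ n * s₀) * b i - c * (r₀ * Y i 2 ^ 2 + r₁ * Y i 3 ^ 2), ?_⟩
      linear_combination hentry i
    have h23 : ∀ i, g ∣ Y i 2 ∧ g ∣ Y i 3 := fun i => by
      obtain ⟨⟨y, hy⟩, ⟨w, hw⟩⟩ := h01 i
      apply hr
      refine (hg.dvd_or_dvd ?_).resolve_left hc
      refine ⟨(g ^ n * s₀) ^ 2 * b i - c * (p₀ * y ^ 2 + p₁ * w ^ 2), ?_⟩
      apply mul_left_cancel₀ hg.ne_zero
      have := hentry i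
      rw [hy, hw] at this
      linear_combination this
    have hall : ∀ i j, g ∣ Y i j := by
      intro i j
      fin_cases j
      exacts [(h01 i).1, (h01 i).2, (h23 i).1, (h23 i).2]
    choose y hy using hall
    refine ih (Matrix.of y) ?_
    ext i j
    have := congrFun (congrFun h i) j
    rw [gram_apply] at this ⊢
    apply mul_left_cancel₀ (pow_ne_zero 2 hg.ne_zero)
    rw [Finset.mul_sum]
    simp only [hy] at this
    refine (Finset.sum_congr rfl fun l _ => ?_).trans (this.trans ?_)
    · rw [Matrix.of_apply, Matrix.of_apply]; ring
    · by_cases hij : i = j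
      · subst hij; rw [diagonal_apply_eq, diagonal_apply_eq]; ring
      · rw [diagonal_apply_ne _ hij, diagonal_apply_ne _ hij, mul_zero]

theorem no_similarity_of_pairAniso [WfDvdMonoid S] {g : S} (hg : Prime g) {b : Fin 4 → S}
    (hb : ∀ i, ¬ g ∣ b i) {e p₀ p₁ r₀ r₁ : S} (he : e ≠ 0)
    (hp : PairAniso g p₀ p₁) (hr : PairAniso g r₀ r₁)
    (hp₀ : p₀ ≠ 0) (hp₁ : p₁ ≠ 0) (hr₀ : r₀ ≠ 0) (hr₁ : r₁ ≠ 0)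
    (Y : Matrix (Fin 4) (Fin 4) S) (h : Y * diagonal b * Yᵀ =
      diagonal fun i => e * ![p₀, p₁, g * r₀, g * r₁] i) : False := by
  have hdet := gram_det h
  have hY : Y.det ≠ 0 := by
    intro h0
    rw [h0, Fin.prod_univ_four (fun i => e * ![p₀, p₁, g * r₀, g * r₁] i)] at hdet
    simp [he, hp₀, hp₁, hr₀, hr₁, hg.ne_zero] at hdet
  have hadj : Y.adjugate * diagonal (fun i => e * ![p₀, p₁, g * r₀, g * r₁] i) * Y.adjugateᵀ =
      diagonal fun i => Y.det ^ 2 * b i := by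
    rw [← h]
    have h1 : Y.adjugate * (Y * diagonal b * Yᵀ) * Y.adjugateᵀ =
        (Y.adjugate * Y) * diagonal b * (Y.adjugate * Y)ᵀ := by
      rw [transpose_mul]; simp only [Matrix.mul_assoc]
    rw [h1, adjugate_mul, transpose_smul, transpose_one, Matrix.smul_mul, Matrix.one_mul,
      Matrix.mul_smul, Matrix.mul_one, smul_smul]
    ext i j
    by_cases hij : i = j
    · subst hij; simp [pow_two]
    · simp [diagonal_apply_ne _ hij]
  generalize Y.adjugate = W at hadj
  obtain ⟨n, s₀, hs₀, hs⟩ := WfDvdMonoid.max_power_factor hY hg.irreducible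
  obtain ⟨j, c, hc, rfl⟩ := WfDvdMonoid.max_power_factor he hg.irreducible
  rw [hs] at hadj
  rcases Nat.even_or_odd' j with ⟨t, rfl | rfl⟩
  · refine no_lattice_of_pairAniso hg hb hc hp hr hs₀ n (W * diagonal fun _ => g ^ t) ?_
    rw [diagonal_fin_four_mul, ← hadj]
    congr 3
    funext i
    fin_cases i <;> simp <;> ring
  · refine no_lattice_of_pairAniso hg hb hc hr hp hs₀ n
      ((W * diagonal ![g ^ t, g ^ t, g ^ (t + 1), g ^ (t + 1)]).submatrix id ![2, 3, 0, 1]) ?_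
    rw [← hadj]
    ext i j
    rw [gram_apply, gram_apply]
    simp only [Fin.sum_univ_four, submatrix_apply, mul_diagonal, Matrix.cons_val, id]
    ring

end Lattice

section Transfer

theorem DiagAniso.of_injective {R R' : Type*} [CommRing R] [CommRing R'] (φ : R →+* R')
    (hφ : Function.Injective φ) {b : Fin 4 → R} (h : DiagAniso fun i => φ (b i)) :
    DiagAniso b := by
  intro x hx
  have := h (fun i => φ (x i)) (by simpa using congrArg φ hx)
  funext i
  exact hφ (by simpa using congrFun this i)

open Polynomial in
theorem DiagAniso.polynomial {R : Type*} [CommRing R] {b : Fin 4 → R} (hb : DiagAniso b) :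
    DiagAniso fun i => (C (b i) : R[X]) := by
  intro x hx
  suffices H : ∀ n, (∀ i m, n ≤ m → (x i).coeff m = 0) → x = 0 by
    refine H (∑ i, ((x i).natDegree + 1)) fun i m hm => coeff_eq_zero_of_natDegree_lt ?_
    have := Finset.single_le_sum (f := fun i => (x i).natDegree + 1) (fun _ _ => Nat.zero_le _)
      (Finset.mem_univ i)
    omega
  intro n
  induction n with
  | zero =>
    exact fun h => funext fun i => Polynomial.ext fun m => by simpa using h i m (Nat.zero_le m)
  | succ n ih =>
    intro h
    have hdeg : ∀ i, (x i).natDegree ≤ n := fun i =>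
      natDegree_le_iff_coeff_eq_zero.2 fun m hm => h i m hm
    have htop : (fun i => (x i).coeff n) = 0 := by
      apply hb
      have := congrArg (fun p => coeff p (n + n)) hx
      simp only [finsetSum_coeff, coeff_C_mul, coeff_zero, pow_two,
        coeff_mul_add_eq_of_natDegree_le (hdeg _) (hdeg _)] at this
      simpa only [pow_two] using this
    refine ih fun i m hm => ?_
    rcases eq_or_lt_of_le hm with rfl | hm'
    · exact congrFun htop i
    · exact h i m hm'

theorem DiagAniso.mvPolynomial {R : Type*} [CommRing R] {b : Fin 4 → R} (hb : DiagAniso b) (n : ℕ) :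
    DiagAniso fun i => (MvPolynomial.C (b i) : MvPolynomial (Fin n) R) := by
  induction n with
  | zero =>
    refine DiagAniso.of_injective (MvPolynomial.isEmptyAlgEquiv R (Fin 0)).toRingEquiv.toRingHom
      (MvPolynomial.isEmptyAlgEquiv R (Fin 0)).injective ?_
    have e (x : R) : MvPolynomial.isEmptyAlgEquiv R (Fin 0) (MvPolynomial.C x) = x :=
      (MvPolynomial.isEmptyAlgEquiv R (Fin 0)).commutes x
    simpa [e] using hb
  | succ n ih =>
    refine DiagAniso.of_injective (MvPolynomial.finSuccEquiv R n).toRingEquiv.toRingHom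
      (MvPolynomial.finSuccEquiv R n).injective ?_
    have := ih.polynomial
    simpa [MvPolynomial.finSuccEquiv_apply] using this

theorem DiagAniso.fractionRing {S : Type*} [CommRing S] [IsDomain S] {F : Type*} [Field F]
    [Algebra S F] [IsFractionRing S F] {b : Fin 4 → S} (hb : DiagAniso b) :
    DiagAniso fun i => algebraMap S F (b i) := by
  intro x hx
  obtain ⟨s, hs⟩ := IsLocalization.exist_integer_multiples_of_finite (nonZeroDivisors S) x
  choose y hy using hs
  have hs0 : algebraMap S F s ≠ 0 := by simp
  have hy' : ∀ i, algebraMap S F (y i) = algebraMap S F s * x i := fun i => by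
    rw [hy, Algebra.smul_def]
  have hy0 : y = 0 := by
    apply hb
    apply IsFractionRing.injective S F
    have e1 : ∀ i, algebraMap S F (b i) * (algebraMap S F s * x i) ^ 2 =
        algebraMap S F s ^ 2 * (algebraMap S F (b i) * x i ^ 2) := fun i => by ring
    simp only [map_sum, map_mul, map_pow, hy', e1]
    rw [← Finset.mul_sum, hx, mul_zero, map_zero]
  funext i
  have := hy' i
  rw [hy0] at this
  simpa [hs0] using this.symm

end Transfer

section Discriminant
open Polynomial

variable {k : Type*} [Field k]

theorem DiagAniso.ne_zero {b : Fin 4 → k} (hb : DiagAniso b) (i : Fin 4) : b i ≠ 0 := by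
  intro h
  have := congrFun (hb (Pi.single i 1) (by simp [Pi.single_apply, h])) i
  simp at this

theorem aeval_omega_eq_zero_iff {S : Type*} [CommRing S] [Nontrivial S] (δ : S) (f : S[X]) :
    aeval (⟨0, 1⟩ : QuadraticAlgebra S δ 0) f = 0 ↔ X ^ 2 - C δ ∣ f := by
  have hmon : (X ^ 2 - C δ).Monic := monic_X_pow_sub_C δ two_ne_zero
  have hzero : aeval (⟨0, 1⟩ : QuadraticAlgebra S δ 0) (X ^ 2 - C δ) = 0 := by
    ext <;> simp [pow_two, QuadraticAlgebra.algebraMap_re, QuadraticAlgebra.algebraMap_im]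
  constructor
  · intro h
    rw [← modByMonic_eq_zero_iff_dvd hmon]
    have hdeg : (f %ₘ (X ^ 2 - C δ)).natDegree ≤ 1 := by
      have := natDegree_modByMonic_lt f hmon (by
        intro h1
        have := congrArg natDegree h1
        simp at this)
      rw [natDegree_X_pow_sub_C] at this
      omega
    have h1 := h
    rw [← modByMonic_add_div f (X ^ 2 - C δ), map_add, map_mul, hzero, zero_mul, add_zero] at h1
    rw [eq_X_add_C_of_natDegree_le_one hdeg] at h1 ⊢
    generalize (f %ₘ (X ^ 2 - C δ)).coeff 1 = x at *
    generalize (f %ₘ (X ^ 2 - C δ)).coeff 0 = y at *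
    have h2 := congrArg QuadraticAlgebra.re h1
    have h3 := congrArg QuadraticAlgebra.im h1
    simp [QuadraticAlgebra.algebraMap_re, QuadraticAlgebra.algebraMap_im] at h2 h3
    simp [h2, h3]
  · rintro ⟨h, rfl⟩
    rw [map_mul, hzero, zero_mul]

theorem aeval_omega_eq_zero_iff_quadratic {a₂ a₃ : k} (ha₂ : a₂ ≠ 0) (f : k[X]) :
    aeval (⟨0, 1⟩ : QuadraticAlgebra k (-(a₃ / a₂)) 0) f = 0 ↔ C a₂ * X ^ 2 + C a₃ ∣ f := by
  have hg : C a₂ * X ^ 2 + C a₃ = C a₂ * (X ^ 2 - C (-(a₃ / a₂))) := by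
    rw [mul_sub, ← C_mul, mul_neg, mul_div_cancel₀ _ ha₂, C_neg, sub_neg_eq_add]
  rw [hg, (isUnit_C.2 ha₂.isUnit).mul_left_dvd, aeval_omega_eq_zero_iff]

theorem fact_sq_ne {a₂ a₃ : k} (ha₂ : a₂ ≠ 0) (h : ∀ r : k, r ^ 2 ≠ -(a₂ * a₃)) :
    Fact (∀ r : k, r ^ 2 ≠ -(a₃ / a₂) + 0 * r) := ⟨fun r hr => h (a₂ * r) (by
      rw [mul_pow, hr]; field_simp; ring)⟩

theorem prime_quadratic {a₂ a₃ : k} (ha₂ : a₂ ≠ 0) (h : ∀ r : k, r ^ 2 ≠ -(a₂ * a₃)) :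
    Prime (C a₂ * X ^ 2 + C a₃) := by
  have := fact_sq_ne ha₂ h
  refine ⟨fun h0 => ?_, fun h1 => ?_, fun p q hpq => ?_⟩
  · have := congrArg (coeff · 2) h0
    simp [ha₂] at this
  · have := natDegree_eq_zero_of_isUnit h1
    rw [natDegree_add_C, natDegree_C_mul_X_pow 2 a₂ ha₂] at this
    omega
  · rw [← aeval_omega_eq_zero_iff_quadratic ha₂] at *
    rw [← aeval_omega_eq_zero_iff_quadratic ha₂]
    rwa [map_mul, mul_eq_zero] at hpq

theorem pairAniso_quadratic (h2 : (2 : k) ≠ 0) {a₂ a₃ d : k} (ha₂ : a₂ ≠ 0)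
    (h : ∀ r : k, r ^ 2 ≠ -(a₂ * a₃)) (hd : ∀ r : k, r ^ 2 ≠ -d)
    (hd' : ∀ r : k, r ^ 2 ≠ d * (a₂ * a₃)) :
    PairAniso (C a₂ * X ^ 2 + C a₃) 1 (C d) := by
  have := fact_sq_ne ha₂ h
  intro y w hyw
  rw [← aeval_omega_eq_zero_iff_quadratic ha₂] at *
  rw [← aeval_omega_eq_zero_iff_quadratic ha₂]
  simp only [map_add, map_mul, one_mul, map_pow, aeval_C] at hyw
  generalize aeval (⟨0, 1⟩ : QuadraticAlgebra k (-(a₃ / a₂)) 0) y = Y at *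
  generalize aeval (⟨0, 1⟩ : QuadraticAlgebra k (-(a₃ / a₂)) 0) w = W at *
  by_cases hW : W = 0
  · subst hW
    simpa using hyw
  exfalso
  have hq : (Y / W) ^ 2 = algebraMap k _ (-d) := by
    field_simp
    rw [map_neg]
    linear_combination hyw
  generalize Y / W = Q at hq
  have e1 := congrArg QuadraticAlgebra.re hq
  have e2 := congrArg QuadraticAlgebra.im hq
  simp only [pow_two, QuadraticAlgebra.re_mul, QuadraticAlgebra.im_mul,
    QuadraticAlgebra.algebraMap_re, QuadraticAlgebra.algebraMap_im] at e1 e2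
  have e3 : Q.re * Q.im = 0 := by
    apply mul_left_cancel₀ h2
    linear_combination e2
  rcases mul_eq_zero.1 e3 with h0 | h0
  · apply hd' (a₃ * Q.im)
    rw [h0] at e1
    field_simp at e1
    linear_combination (-a₃) * e1
  · apply hd Q.re
    rw [h0] at e1
    linear_combination e1

end Discriminant

section Similarity
open Polynomial Matrix

variable {k : Type*} [Field k]

theorem DiagAniso.sq_ne_zero_one {a : Fin 4 → k} (ha : DiagAniso a) (r : k) :
    r ^ 2 ≠ -(a 0 * a 1) := by
  intro hr
  have := congrFun (ha ![r, a 0, 0, 0] (by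
    simp only [Fin.sum_univ_four, Matrix.cons_val]; linear_combination a 0 * hr)) 1
  exact ha.ne_zero 0 (by simpa using this)

theorem DiagAniso.sq_ne_two_three {a : Fin 4 → k} (ha : DiagAniso a) (r : k) :
    r ^ 2 ≠ -(a 2 * a 3) := by
  intro hr
  have := congrFun (ha ![0, 0, r, a 2] (by
    simp only [Fin.sum_univ_four, Matrix.cons_val]; linear_combination a 2 * hr)) 3
  exact ha.ne_zero 2 (by simpa using this)

variable {F : Type*} [Field F] [Algebra k[X] F] [IsFractionRing k[X] F]

theorem disc_dichotomy (h2 : (2 : k) ≠ 0) {a b : Fin 4 → k} (ha : DiagAniso a)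
    (hb : DiagAniso b) {U : Matrix (Fin 4) (Fin 4) F} {c : F} (hc : c ≠ 0)
    (h : U * diagonal (fun i => algebraMap k[X] F (C (b i))) * Uᵀ =
      diagonal fun i => c * algebraMap k[X] F (![C (a 0), C (a 1), (C (a 2) * X ^ 2 + C (a 3)) * 1,
        (C (a 2) * X ^ 2 + C (a 3)) * C (a 0 * a 1 * ∏ i, b i)] i)) :
    (∃ r, r ^ 2 = ∏ i, a i) ∨ ∃ r, r ^ 2 = (∏ i, a i) * ∏ i, b i := by
  by_contra! hcon
  obtain ⟨h1, h3⟩ := hcon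
  have hg := prime_quadratic (ha.ne_zero 2) ha.sq_ne_two_three
  have hbF : DiagAniso fun i => algebraMap k[X] F (C (b i)) := hb.polynomial.fractionRing
  have he0 : a 0 * a 1 * ∏ i, b i ≠ 0 :=
    mul_ne_zero (mul_ne_zero (ha.ne_zero 0) (ha.ne_zero 1))
      (Finset.prod_ne_zero_iff.2 fun i _ => hb.ne_zero i)
  have he : ∀ r : k, r ^ 2 ≠ -(a 0 * a 1 * ∏ i, b i) := by
    intro r hr
    have e22 := congrFun (congrFun h 2) 2
    have e23 := congrFun (congrFun h 2) 3
    have e33 := congrFun (congrFun h 3) 3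
    rw [gram_apply] at e22 e23 e33
    generalize hE : a 0 * a 1 * ∏ i, b i = E at *
    rw [diagonal_apply_eq] at e22 e33
    rw [diagonal_apply_ne _ (by decide)] at e23
    simp only [Matrix.cons_val, mul_one] at e22 e33
    have hr' : algebraMap k[X] F (C r) ^ 2 = - algebraMap k[X] F (C E) := by
      rw [← map_pow, ← map_pow, hr, map_neg, map_neg]
    have hzero := hbF (fun l => algebraMap k[X] F (C r) * U 2 l + U 3 l) (by
      simp only [Fin.sum_univ_four, map_mul] at e22 e23 e33 ⊢
      linear_combination (algebraMap k[X] F (C r)) ^ 2 * e22 + 2 * algebraMap k[X] F (C r) * e23 +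
        e33 + c * algebraMap k[X] F (C (a 2) * X ^ 2 + C (a 3)) * hr')
    have h3 : ∀ l, U 3 l = - (algebraMap k[X] F (C r) * U 2 l) := fun l => by
      have := congrFun hzero l
      simp only [Pi.zero_apply] at this
      linear_combination this
    simp only [h3, Fin.sum_univ_four] at e22 e23
    have : algebraMap k[X] F (C r) * (c * algebraMap k[X] F (C (a 2) * X ^ 2 + C (a 3))) = 0 := by
      linear_combination - e23 - algebraMap k[X] F (C r) * e22
    have hr0 : algebraMap k[X] F (C r) ≠ 0 := by
      intro h0
      rw [h0, zero_pow two_ne_zero, zero_eq_neg] at hr'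
      exact he0 (by simpa using hr')
    have hgF : algebraMap k[X] F (C (a 2) * X ^ 2 + C (a 3)) ≠ 0 := fun h0 =>
      hg.ne_zero ((IsFractionRing.injective k[X] F) (by rw [h0, map_zero]))
    exact (mul_ne_zero hr0 (mul_ne_zero hc hgF)) this
  have hp : PairAniso (C (a 2) * X ^ 2 + C (a 3)) (C (a 0)) (C (a 1)) := by
    intro y w hyw
    have := pairAniso_quadratic h2 (ha.ne_zero 2) ha.sq_ne_two_three ha.sq_ne_zero_one
      (fun r hr => h1 r (by rw [hr, Fin.prod_univ_four]; ring)) (C (a 0) * y) w (by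
        obtain ⟨t, ht⟩ := hyw
        refine ⟨C (a 0) * t, ?_⟩
        simp only [C_mul]
        linear_combination C (a 0) * ht)
    rwa [(isUnit_C.2 (ha.ne_zero 0).isUnit).dvd_mul_left] at this
  have hr : PairAniso (C (a 2) * X ^ 2 + C (a 3)) 1 (C (a 0 * a 1 * ∏ i, b i)) :=
    pairAniso_quadratic h2 (ha.ne_zero 2) ha.sq_ne_two_three he
      (fun r hr => h3 r (by rw [hr, Fin.prod_univ_four a]; ring))
  obtain ⟨Y, e, he, hY⟩ := exists_integral_gram hc h
  refine no_similarity_of_pairAniso hg (fun i hi => ?_) he hp hr ?_ ?_ one_ne_zero ?_ Y hY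
  · exact hg.not_isUnit (isUnit_of_dvd_unit hi (isUnit_C.2 (hb.ne_zero i).isUnit))
  · simpa using ha.ne_zero 0
  · simpa using ha.ne_zero 1
  · exact C_ne_zero.2 he0

theorem gram_of_disc_eq {a b : Fin 4 → k} (ha : DiagAniso a) (hb : DiagAniso b)
    (hab : ∃ r, r ^ 2 = (∏ i, a i) * ∏ i, b i) {U : Matrix (Fin 4) (Fin 4) F} {c : F}
    (h : U * diagonal (fun i => algebraMap k[X] F (C (b i))) * Uᵀ =
      diagonal fun i => c * algebraMap k[X] F (![C (a 0), C (a 1), (C (a 2) * X ^ 2 + C (a 3)) * 1,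
        (C (a 2) * X ^ 2 + C (a 3)) * C (a 0 * a 1 * ∏ i, b i)] i)) :
    ∃ U : Matrix (Fin 4) (Fin 4) F, U * diagonal (fun i => algebraMap k[X] F (C (b i))) * Uᵀ =
      diagonal fun i => c * algebraMap k[X] F (C (a i)) := by
  obtain ⟨r, hr⟩ := hab
  have hg : algebraMap k[X] F (C (a 2) * X ^ 2 + C (a 3)) ≠ 0 := fun h0 =>
    (prime_quadratic (ha.ne_zero 2) ha.sq_ne_two_three).ne_zero
      ((IsFractionRing.injective k[X] F) (by rw [h0, map_zero]))
  have hr0 : r ≠ 0 := by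
    rintro rfl
    rw [zero_pow two_ne_zero, zero_eq_mul] at hr
    rcases hr with h | h
    · exact Finset.prod_ne_zero_iff.2 (fun i _ => ha.ne_zero i) h
    · exact Finset.prod_ne_zero_iff.2 (fun i _ => hb.ne_zero i) h
  have hr1 : algebraMap k[X] F (C r) ≠ 0 := by simpa using hr0
  have hr2 : algebraMap k[X] F (C (a 2)) * algebraMap k[X] F (C (a 3)) *
      algebraMap k[X] F (C (a 0 * a 1 * ∏ i, b i)) = algebraMap k[X] F (C r) ^ 2 := by
    rw [← map_pow, ← map_pow, hr, Fin.prod_univ_four a]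
    simp only [← map_mul]
    congr 2
    ring
  have hgdef : algebraMap k[X] F (C (a 2) * X ^ 2 + C (a 3)) = algebraMap k[X] F (C (a 2)) *
    algebraMap k[X] F X ^ 2 + algebraMap k[X] F (C (a 3)) := by simp
  refine ⟨!![1, 0, 0, 0; 0, 1, 0, 0;
    0, 0, algebraMap k[X] F (C (a 2)) * algebraMap k[X] F X /
        algebraMap k[X] F (C (a 2) * X ^ 2 + C (a 3)),
      algebraMap k[X] F (C (a 2)) * algebraMap k[X] F (C (a 3)) / algebraMap k[X] F (C r) /
        algebraMap k[X] F (C (a 2) * X ^ 2 + C (a 3));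
    0, 0, algebraMap k[X] F (C (a 3)) / algebraMap k[X] F (C (a 2) * X ^ 2 + C (a 3)),
      - (algebraMap k[X] F X * (algebraMap k[X] F (C (a 2)) * algebraMap k[X] F (C (a 3)) /
        algebraMap k[X] F (C r))) / algebraMap k[X] F (C (a 2) * X ^ 2 + C (a 3))] * U, ?_⟩
  rw [transpose_mul, Matrix.mul_assoc, Matrix.mul_assoc, ← Matrix.mul_assoc (diagonal _),
    ← Matrix.mul_assoc U, ← Matrix.mul_assoc U, h, ← Matrix.mul_assoc]
  generalize a 0 * a 1 * ∏ i, b i = E at *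
  ext i j
  rw [gram_apply]
  simp only [Fin.sum_univ_four, Matrix.cons_val, mul_one, map_mul]
  generalize algebraMap k[X] F (C (a 2) * X ^ 2 + C (a 3)) = g at *
  generalize algebraMap k[X] F (C E) = E' at *
  generalize algebraMap k[X] F (C r) = r' at *
  have h02 : (algebraMap k[X] F) (C (a 2)) ≠ 0 := by simpa using ha.ne_zero 2
  have h03 : (algebraMap k[X] F) (C (a 3)) ≠ 0 := by simpa using ha.ne_zero 3
  fin_cases i <;> fin_cases j <;> simp [diagonal]
  all_goals field_simp
  all_goals generalize algebraMap k[X] F (C (a 2)) = A at *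
  all_goals generalize algebraMap k[X] F (C (a 3)) = B at *
  all_goals generalize algebraMap k[X] F X = Z at *
  · linear_combination c * B * hr2 - c * r' ^ 2 * hgdef
  · linear_combination - c * A * B * Z * hr2
  · linear_combination - c * A * B * Z * hr2
  · linear_combination c * A * Z ^ 2 * hr2 - c * r' ^ 2 * hgdef

/-- Specialisation of a similarity over `k(X)` at the origin. -/
theorem exists_gram_of_polynomial_gram {a b : Fin 4 → k} (ha : DiagAniso a) (hb : DiagAniso b)
    {e : k[X]} (he : e ≠ 0) (Y : Matrix (Fin 4) (Fin 4) k[X])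
    (h : Y * diagonal (fun i => C (b i)) * Yᵀ = diagonal fun i => e * C (a i)) :
    ∃ (M : Matrix (Fin 4) (Fin 4) k) (c : k), c ≠ 0 ∧
      M * diagonal b * Mᵀ = diagonal fun i => c * a i := by
  obtain ⟨j, e, hX, rfl⟩ := WfDvdMonoid.max_power_factor he (irreducible_X (R := k))
  have h0 : e.coeff 0 ≠ 0 := fun h0 => hX (X_dvd_iff.2 h0)
  clear he
  induction j using Nat.strong_induction_on generalizing Y with
  | _ j ih =>
  have heval : ∀ i l, ∑ t, b t * (Y i t).coeff 0 * (Y l t).coeff 0 =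
      if i = l then (X ^ j * e).coeff 0 * a i else 0 := by
    intro i l
    have := congrArg (fun p => coeff p 0) (congrFun (congrFun h i) l)
    rw [gram_apply] at this
    simp only [finsetSum_coeff, mul_coeff_zero, coeff_C_zero, diagonal_apply] at this
    rw [this]
    split_ifs <;> simp
  rcases j with _ | j
  · refine ⟨Y.map fun p => p.coeff 0, e.coeff 0, h0, ?_⟩
    ext i l
    rw [gram_apply, diagonal_apply]
    simp only [Matrix.map_apply]
    rw [heval]
    simp
  · have hdvd : ∀ i l, X ∣ Y i l := by
      intro i l
      rw [X_dvd_iff]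
      refine congrFun (hb (fun t => (Y i t).coeff 0) ?_) l
      have := heval i i
      simp only [if_true, mul_coeff_zero, coeff_X_pow] at this
      rw [← Finset.sum_congr rfl fun t _ => show b t * (Y i t).coeff 0 * (Y i t).coeff 0 =
        b t * (Y i t).coeff 0 ^ 2 by ring, this]
      simp
    choose y hy using hdvd
    have hy2 : X * (Matrix.of y * diagonal (fun i => C (b i)) * (Matrix.of y)ᵀ) 0 0 =
        X ^ j * e * C (a 0) := by
      have := congrFun (congrFun h 0) 0
      rw [gram_apply, diagonal_apply_eq] at this
      rw [gram_apply]
      apply mul_left_cancel₀ (X_ne_zero (R := k))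
      simp only [hy] at this
      simp only [Matrix.of_apply, Fin.sum_univ_four] at this ⊢
      linear_combination this
    rcases j with _ | j
    · exfalso
      apply hX
      rw [pow_zero, one_mul] at hy2
      rw [← (isUnit_C.2 (ha.ne_zero 0).isUnit).dvd_mul_right, ← hy2]
      exact dvd_mul_right _ _
    · refine ih j (by omega) (Matrix.of y) ?_
      ext1 i l
      have := congrFun (congrFun h i) l
      rw [gram_apply] at this ⊢
      apply mul_left_cancel₀ (pow_ne_zero 2 (X_ne_zero (R := k)))
      simp only [hy] at this
      rw [Finset.mul_sum]
      refine (Finset.sum_congr rfl fun t _ => ?_).trans (this.trans ?_)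
      · rw [Matrix.of_apply, Matrix.of_apply]; ring
      · by_cases hij : i = l
        · subst hij; rw [diagonal_apply_eq, diagonal_apply_eq]; ring
        · rw [diagonal_apply_ne _ hij, diagonal_apply_ne _ hij, mul_zero]

end Similarity

section Solutions
open Polynomial

/-- The form `⟨b₀, b₁, b₂, b₃⟩` has a nontrivial zero `A + B √D` over `R[√D]`. -/
def ConicSol {R : Type*} [CommRing R] (b : Fin 4 → R) (D : R) : Prop :=
  ∃ A B : Fin 4 → R, (A ≠ 0 ∨ B ≠ 0) ∧ ∑ i, b i * A i ^ 2 + D * ∑ i, b i * B i ^ 2 = 0 ∧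
    ∑ i, b i * A i * B i = 0

theorem ConicSol.map {R R' : Type*} [CommRing R] [CommRing R'] {φ : R →+* R'}
    (hφ : Function.Injective φ) {b : Fin 4 → R} {D : R} (h : ConicSol b D) :
    ConicSol (fun i => φ (b i)) (φ D) := by
  obtain ⟨A, B, hAB, h1, h2⟩ := h
  refine ⟨fun i => φ (A i), fun i => φ (B i), ?_, ?_, ?_⟩
  · refine hAB.imp (fun h h0 => h ?_) (fun h h0 => h ?_)
    · funext i; exact hφ (by simpa using congrFun h0 i)
    · funext i; exact hφ (by simpa using congrFun h0 i)
  · simpa using congrArg φ h1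
  · simpa using congrArg φ h2

theorem ConicSol.eval {R : Type*} [CommRing R] [IsDomain R] {b : Fin 4 → R} {D : R[X]} (x : R)
    (h : ConicSol (fun i => C (b i)) D) : ConicSol b (D.eval x) := by
  obtain ⟨A, B, hAB, h1, h2⟩ := h
  obtain ⟨n, f, hf, hn⟩ : ∃ n f, ¬ (X - C x) ∣ f ∧
      ((∃ i, A i = (X - C x) ^ n * f) ∨ ∃ i, B i = (X - C x) ^ n * f) := by
    rcases hAB with h | h
    · obtain ⟨i, hi⟩ := Function.ne_iff.1 h
      obtain ⟨f, hf, hf'⟩ := exists_eq_pow_rootMultiplicity_mul_and_not_dvd (A i) hi x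
      exact ⟨_, f, hf', Or.inl ⟨i, hf⟩⟩
    · obtain ⟨i, hi⟩ := Function.ne_iff.1 h
      obtain ⟨f, hf, hf'⟩ := exists_eq_pow_rootMultiplicity_mul_and_not_dvd (B i) hi x
      exact ⟨_, f, hf', Or.inr ⟨i, hf⟩⟩
  clear hAB
  induction n generalizing A B with
  | zero =>
    refine ⟨fun i => (A i).eval x, fun i => (B i).eval x, ?_, ?_, ?_⟩
    · rw [dvd_iff_isRoot] at hf
      rcases hn with ⟨i, hi⟩ | ⟨i, hi⟩
      · exact Or.inl fun h0 => hf (by simpa [hi] using congrFun h0 i)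
      · exact Or.inr fun h0 => hf (by simpa [hi] using congrFun h0 i)
    · simpa [eval_finsetSum] using congrArg (Polynomial.eval x) h1
    · simpa [eval_finsetSum] using congrArg (Polynomial.eval x) h2
  | succ n ih =>
    by_cases hdvd : (∀ i, X - C x ∣ A i) ∧ ∀ i, X - C x ∣ B i
    · obtain ⟨hA, hB⟩ := hdvd
      choose A' hA using hA
      choose B' hB using hB
      have hne : X - C x ≠ 0 := X_sub_C_ne_zero x
      refine ih A' B' ?_ ?_ ?_
      · apply mul_left_cancel₀ (pow_ne_zero 2 hne)
        simp only [hA, hB, Fin.sum_univ_four] at h1 ⊢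
        linear_combination h1
      · apply mul_left_cancel₀ (pow_ne_zero 2 hne)
        simp only [hA, hB, Fin.sum_univ_four] at h2 ⊢
        linear_combination h2
      · rcases hn with ⟨i, hi⟩ | ⟨i, hi⟩
        · exact Or.inl ⟨i, mul_left_cancel₀ hne (by rw [← hA, hi]; ring)⟩
        · exact Or.inr ⟨i, mul_left_cancel₀ hne (by rw [← hB, hi]; ring)⟩
    · refine ⟨fun i => (A i).eval x, fun i => (B i).eval x, ?_, ?_, ?_⟩
      · simp only [dvd_iff_isRoot] at hdvd
        by_contra! h0
        exact hdvd ⟨fun i => congrFun h0.1 i, fun i => congrFun h0.2 i⟩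
      · simpa [eval_finsetSum] using congrArg (Polynomial.eval x) h1
      · simpa [eval_finsetSum] using congrArg (Polynomial.eval x) h2

/-- The leading coefficients of an anisotropic form do not cancel. -/
theorem DiagAniso.natDegree_le {R : Type*} [CommRing R] {b : Fin 4 → R} (hb : DiagAniso b)
    {x : Fin 4 → R[X]} {m : ℕ} (hm : (∑ i, C (b i) * x i ^ 2).natDegree ≤ 2 * m + 1) (i : Fin 4) :
    (x i).natDegree ≤ m := by
  suffices H : ∀ n, (∀ i, (x i).natDegree ≤ m + n) → ∀ i, (x i).natDegree ≤ m by
    refine H (∑ i, (x i).natDegree) (fun i => ?_) i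
    have := Finset.single_le_sum (f := fun i => (x i).natDegree) (fun _ _ => Nat.zero_le _)
      (Finset.mem_univ i)
    omega
  intro n
  induction n with
  | zero => exact fun h => h
  | succ n ih =>
    intro h
    have htop : (fun i => (x i).coeff (m + (n + 1))) = 0 := by
      apply hb
      have := coeff_eq_zero_of_natDegree_lt (n := (m + (n + 1)) + (m + (n + 1)))
        (lt_of_le_of_lt hm (by omega))
      simp only [finsetSum_coeff, coeff_C_mul, pow_two,
        coeff_mul_add_eq_of_natDegree_le (h _) (h _)] at this
      simpa only [pow_two] using this
    refine ih fun i => ?_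
    rw [natDegree_le_iff_coeff_eq_zero]
    intro N hN
    rcases eq_or_lt_of_le (Nat.succ_le_of_lt hN) with h' | h'
    · rw [← h']; exact congrFun htop i
    · exact coeff_eq_zero_of_natDegree_lt (lt_of_le_of_lt (h i) h')

theorem DiagAniso.not_conicSol {R : Type*} [CommRing R] [IsDomain R] (h2 : (2 : R) ≠ 0)
    {b : Fin 4 → R} (hb : DiagAniso b) {z d₁ d₀ : R} (hz : z ≠ 0) :
    ¬ ConicSol (fun i => C (b i)) (C z ^ 2 * X ^ 2 + C d₁ * X + C d₀) := by
  rintro ⟨A, B, hAB, h1, h3⟩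
  have hB : B = 0 := by
    suffices H : ∀ n, (∀ i m, n ≤ m → (B i).coeff m = 0) → B = 0 by
      refine H (∑ i, ((B i).natDegree + 1)) fun i m hm => coeff_eq_zero_of_natDegree_lt ?_
      have := Finset.single_le_sum (f := fun i => (B i).natDegree + 1) (fun _ _ => Nat.zero_le _)
        (Finset.mem_univ i)
      omega
    intro n
    induction n with
    | zero =>
      exact fun h => funext fun i => Polynomial.ext fun m => by simpa using h i m (Nat.zero_le m)
    | succ n ih =>
      intro h
      have hdeg : ∀ i, (B i).natDegree ≤ n := fun i =>
        natDegree_le_iff_coeff_eq_zero.2 fun m hm => h i m hm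
      have hE : (-((C d₁ * X + C d₀) * ∑ i, C (b i) * B i ^ 2)).natDegree ≤ 2 * n + 1 := by
        rw [natDegree_neg, add_comm (2 * n)]
        refine natDegree_mul_le_of_le natDegree_linear_le (natDegree_sum_le_of_forall_le _ _
          fun i _ => (natDegree_C_mul_le _ _).trans ?_)
        exact (natDegree_pow_le_of_le 2 (hdeg i))
      have hp : ∀ i, (A i + C z * X * B i).natDegree ≤ n := hb.natDegree_le (by
        convert hE using 2
        simp only [Fin.sum_univ_four] at h1 h3 ⊢
        linear_combination h1 + 2 * C z * X * h3)
      have hq : ∀ i, (A i - C z * X * B i).natDegree ≤ n := hb.natDegree_le (by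
        convert hE using 2
        simp only [Fin.sum_univ_four] at h1 h3 ⊢
        linear_combination h1 - 2 * C z * X * h3)
      refine ih fun i m hm => ?_
      rcases eq_or_lt_of_le hm with rfl | hm'
      · have e1 := coeff_eq_zero_of_natDegree_lt (Nat.lt_succ_of_le (hp i))
        have e2 := coeff_eq_zero_of_natDegree_lt (Nat.lt_succ_of_le (hq i))
        rw [mul_assoc, Nat.succ_eq_add_one, coeff_add, coeff_C_mul, coeff_X_mul] at e1
        rw [mul_assoc, Nat.succ_eq_add_one, coeff_sub, coeff_C_mul, coeff_X_mul] at e2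
        apply mul_left_cancel₀ (mul_ne_zero h2 hz)
        linear_combination e1 - e2
      · exact h i m hm'
  have hA : A = 0 := by
    apply hb.polynomial
    simpa [hB] using h1
  simp [hA, hB] at hAB

end Solutions

section Domination

variable {k : Type*} [Field k]

/-- The quadratic form `a₀ X₀² + a₁ X₁² + a₂ X₂² + a₃ X₃²` as a polynomial. -/
def diagPoly (a : Fin 4 → k) : MvPolynomial (Fin 4) k :=
  ∑ i, MvPolynomial.C (a i) * MvPolynomial.X i ^ 2

/-- There is a rational map from the quadric `a₀ X₀² + ⋯ + a₃ X₃² = 0` to the quadric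
`b₀ X₀² + ⋯ + b₃ X₃² = 0`. -/
def RationalMap (a b : Fin 4 → k) : Prop :=
  ∃ P : Fin 4 → MvPolynomial (Fin 4) k,
    diagPoly a ∣ ∑ i, MvPolynomial.C (b i) * P i ^ 2 ∧ ∃ i, ¬ diagPoly a ∣ P i

theorem RationalMap.perm {a b : Fin 4 → k} (h : RationalMap a b) (σ : Equiv.Perm (Fin 4)) :
    RationalMap (fun i => a (σ i)) b := by
  obtain ⟨P, hP, i, hi⟩ := h
  have e : MvPolynomial.renameEquiv k σ.symm (diagPoly a) = diagPoly fun i => a (σ i) := by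
    simp only [diagPoly, map_sum, map_mul, map_pow, MvPolynomial.renameEquiv_apply,
      MvPolynomial.rename_C, MvPolynomial.rename_X]
    rw [← Equiv.sum_comp σ]
    simp
  refine ⟨fun i => MvPolynomial.renameEquiv k σ.symm (P i), ?_, i, ?_⟩
  · have := map_dvd (MvPolynomial.renameEquiv k σ.symm) hP
    rw [e] at this
    simpa using this
  · rwa [← e, map_dvd_iff]

theorem two_ne_zero_mvPolynomial (h2 : (2 : k) ≠ 0) (σ : Type*) : (2 : MvPolynomial σ k) ≠ 0 := by
  intro h0
  apply h2
  apply MvPolynomial.C_injective σ k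
  rw [map_ofNat, map_zero, h0]

theorem RationalMap.conicSol (h2 : (2 : k) ≠ 0) {a b : Fin 4 → k} (ha : a 0 ≠ 0)
    (h : RationalMap a b) :
    ConicSol (fun i => (MvPolynomial.C (b i) : MvPolynomial (Fin 3) k))
      (MvPolynomial.C (-a 1 / a 0) * MvPolynomial.X 0 ^ 2 +
        MvPolynomial.C (-a 2 / a 0) * MvPolynomial.X 1 ^ 2 +
        MvPolynomial.C (-a 3 / a 0) * MvPolynomial.X 2 ^ 2) := by
  obtain ⟨P, hP, i, hi⟩ := h
  generalize hD : (MvPolynomial.C (-a 1 / a 0) * MvPolynomial.X 0 ^ 2 +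
        MvPolynomial.C (-a 2 / a 0) * MvPolynomial.X 1 ^ 2 +
        MvPolynomial.C (-a 3 / a 0) * MvPolynomial.X 2 ^ 2 : MvPolynomial (Fin 3) k) = D
  have e : MvPolynomial.finSuccEquiv k 3 (diagPoly a) =
      Polynomial.C (MvPolynomial.C (a 0)) * (Polynomial.X ^ 2 - Polynomial.C D) := by
    have e1 : MvPolynomial.finSuccEquiv k 3 (MvPolynomial.X 1) =
        Polynomial.C (MvPolynomial.X 0) := MvPolynomial.finSuccEquiv_X_succ (j := 0)
    have e2 : MvPolynomial.finSuccEquiv k 3 (MvPolynomial.X 2) =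
        Polynomial.C (MvPolynomial.X 1) := MvPolynomial.finSuccEquiv_X_succ (j := 1)
    have e3 : MvPolynomial.finSuccEquiv k 3 (MvPolynomial.X 3) =
        Polynomial.C (MvPolynomial.X 2) := MvPolynomial.finSuccEquiv_X_succ (j := 2)
    have eC (x : k) : MvPolynomial.finSuccEquiv k 3 (MvPolynomial.C x) =
        Polynomial.C (MvPolynomial.C x) := by simp [MvPolynomial.finSuccEquiv_apply]
    have hc (i : Fin 4) : (MvPolynomial.C (a 0) : MvPolynomial (Fin 3) k) *
        MvPolynomial.C (-a i / a 0) = -MvPolynomial.C (a i) := by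
      rw [← MvPolynomial.C_mul, mul_div_cancel₀ _ ha, MvPolynomial.C_neg]
    have hD' : MvPolynomial.C (a 0) * D = -(MvPolynomial.C (a 1) * MvPolynomial.X 0 ^ 2 +
        MvPolynomial.C (a 2) * MvPolynomial.X 1 ^ 2 +
        MvPolynomial.C (a 3) * MvPolynomial.X 2 ^ 2) := by
      rw [← hD]
      linear_combination MvPolynomial.X 0 ^ 2 * hc 1 + MvPolynomial.X 1 ^ 2 * hc 2 +
        MvPolynomial.X 2 ^ 2 * hc 3
    rw [mul_sub, ← Polynomial.C_mul, hD']
    simp only [diagPoly, Fin.sum_univ_four, map_add, map_mul, map_pow, map_neg,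
      MvPolynomial.finSuccEquiv_X_zero, e1, e2, e3, eC]
    ring
  have hunit : IsUnit (Polynomial.C (MvPolynomial.C (a 0)) :
      Polynomial (MvPolynomial (Fin 3) k)) :=
    (ha.isUnit.map MvPolynomial.C).map Polynomial.C
  set Φ : MvPolynomial (Fin 4) k →+* QuadraticAlgebra (MvPolynomial (Fin 3) k) D 0 :=
    (Polynomial.aeval (⟨0, 1⟩ : QuadraticAlgebra (MvPolynomial (Fin 3) k) D 0)).toRingHom.comp
      (MvPolynomial.finSuccEquiv k 3).toRingEquiv.toRingHom with hΦ
  have hker (p : MvPolynomial (Fin 4) k) : Φ p = 0 ↔ diagPoly a ∣ p := by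
    rw [← map_dvd_iff (MvPolynomial.finSuccEquiv k 3), e, hunit.mul_left_dvd,
      ← aeval_omega_eq_zero_iff]
    rfl
  have hC (x : k) : Φ (MvPolynomial.C x) =
      algebraMap (MvPolynomial (Fin 3) k) _ (MvPolynomial.C x) := by
    simp [hΦ, MvPolynomial.finSuccEquiv_apply]
  have hz := (hker _).2 hP
  rw [← hker] at hi
  simp only [map_sum, map_mul, map_pow, hC] at hz
  have h2' := two_ne_zero_mvPolynomial h2 (Fin 3)
  refine ⟨fun i => (Φ (P i)).re, fun i => (Φ (P i)).im, ?_, ?_, ?_⟩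
  · by_contra! h0
    exact hi (QuadraticAlgebra.ext (congrFun h0.1 i) (congrFun h0.2 i))
  · have := congrArg QuadraticAlgebra.re hz
    simp [Fin.sum_univ_four, pow_two, QuadraticAlgebra.algebraMap_re,
      QuadraticAlgebra.algebraMap_im] at this
    simp only [Fin.sum_univ_four]
    linear_combination this
  · have := congrArg QuadraticAlgebra.im hz
    simp [Fin.sum_univ_four, pow_two, QuadraticAlgebra.algebraMap_re,
      QuadraticAlgebra.algebraMap_im] at this
    simp only [Fin.sum_univ_four]
    apply mul_left_cancel₀ h2'
    linear_combination this

end Domination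

section Isotropic
open Polynomial

variable {k : Type*} [Field k]

theorem RationalMap.not_diagAniso (h2 : (2 : k) ≠ 0) {a b : Fin 4 → k} (ha : ∀ i, a i ≠ 0)
    (hiso : ¬ DiagAniso a) (h : RationalMap a b) : ¬ DiagAniso b := by
  intro hb
  obtain ⟨z, hz, hz0⟩ : ∃ z : Fin 4 → k, ∑ i, a i * z i ^ 2 = 0 ∧ z ≠ 0 := by
    simpa [DiagAniso] using hiso
  obtain ⟨j, hj⟩ := Function.ne_iff.1 hz0
  rw [Pi.zero_apply] at hj
  wlog hj0 : z 0 ≠ 0 generalizing a z j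
  · refine this (fun i => ha (Equiv.swap 0 j i)) ?_ (h.perm (Equiv.swap 0 j))
      (fun i => z (Equiv.swap 0 j i)) ?_ ?_ 0 ?_ ?_
    · intro h'
      have := h' (fun i => z (Equiv.swap 0 j i)) (by
        rw [← hz, ← Equiv.sum_comp (Equiv.swap 0 j) fun i => a i * z i ^ 2])
      have := congrFun this 0
      simp [hj] at this
    · rw [← hz, ← Equiv.sum_comp (Equiv.swap 0 j) fun i => a i * z i ^ 2]
    · intro h'
      have := congrFun h' 0
      simp [hj] at this
    · simpa using hj
    · simpa using hj
  have hsol := h.conicSol h2 (ha 0)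
  set τ : MvPolynomial (Fin 3) k →+* (MvPolynomial (Fin 3) k)[X] :=
    MvPolynomial.eval₂Hom (C.comp MvPolynomial.C)
      fun i => C (MvPolynomial.C (z i.succ)) * X + C (MvPolynomial.X i) with hτ
  have hinj : Function.Injective τ := by
    have : (evalRingHom 0).comp τ = RingHom.id _ := by
      apply MvPolynomial.ringHom_ext <;> simp [hτ]
    exact Function.LeftInverse.injective (g := evalRingHom 0) fun p => RingHom.congr_fun this p
  have hsol' := hsol.map hinj
  have hC (x : k) : τ (MvPolynomial.C x) = C (MvPolynomial.C x) := by simp [hτ]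
  have hX (i : Fin 3) : τ (MvPolynomial.X i) =
      C (MvPolynomial.C (z i.succ)) * X + C (MvPolynomial.X i) := by simp [hτ]
  have hzz : -a 1 / a 0 * z 1 ^ 2 + -a 2 / a 0 * z 2 ^ 2 + -a 3 / a 0 * z 3 ^ 2 = z 0 ^ 2 := by
    rw [Fin.sum_univ_four] at hz
    have := ha 0
    field_simp
    linear_combination -hz
  have hzz' := congrArg (fun x : k => (C (MvPolynomial.C x) : (MvPolynomial (Fin 3) k)[X])) hzz
  simp only [map_add, map_mul, map_pow] at hzz'
  have e1 : (Fin.succ 0 : Fin 4) = 1 := rfl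
  have e2 : (Fin.succ 1 : Fin 4) = 2 := rfl
  have e3 : (Fin.succ 2 : Fin 4) = 3 := rfl
  refine (hb.mvPolynomial 3).not_conicSol (z := MvPolynomial.C (z 0))
    (d₁ := 2 * (MvPolynomial.C (-a 1 / a 0 * z 1) * MvPolynomial.X 0 +
      MvPolynomial.C (-a 2 / a 0 * z 2) * MvPolynomial.X 1 +
      MvPolynomial.C (-a 3 / a 0 * z 3) * MvPolynomial.X 2))
    (d₀ := MvPolynomial.C (-a 1 / a 0) * MvPolynomial.X 0 ^ 2 +
        MvPolynomial.C (-a 2 / a 0) * MvPolynomial.X 1 ^ 2 +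
        MvPolynomial.C (-a 3 / a 0) * MvPolynomial.X 2 ^ 2) ?_ ?_ ?_
  · exact two_ne_zero_mvPolynomial h2 (Fin 3)
  · simpa using hj0
  · convert hsol' using 1
    · funext i; rw [hC]
    · simp only [map_add, map_mul, map_pow, hC, hX, e1, e2, e3, map_ofNat]
      linear_combination -X ^ 2 * hzz'

theorem RationalMap.exists_gram (F : Type*) [Field F] [Algebra k[X] F] [IsFractionRing k[X] F]
    (h2 : (2 : k) ≠ 0) {a b : Fin 4 → k} (ha : DiagAniso a)
    (hb : DiagAniso b) (h : RationalMap a b) :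
    ∃ (U : Matrix (Fin 4) (Fin 4) F) (c : F), c ≠ 0 ∧
      U * Matrix.diagonal (fun i => algebraMap k[X] F (C (b i))) * U.transpose =
      Matrix.diagonal fun i => c * algebraMap k[X] F
        (![C (a 0), C (a 1), (C (a 2) * X ^ 2 + C (a 3)) * 1,
        (C (a 2) * X ^ 2 + C (a 3)) * C (a 0 * a 1 * ∏ i, b i)] i) := by
  obtain ⟨σ, s0, s1, s2, s3⟩ : ∃ σ : Equiv.Perm (Fin 4), σ 0 = 0 ∧ σ 1 = 3 ∧ σ 2 = 1 ∧ σ 3 = 2 :=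
    ⟨Equiv.swap 1 2 * Equiv.swap 1 3, by decide⟩
  have hσ := RationalMap.conicSol (a := fun i => a (σ i)) h2 (ha.ne_zero (σ 0)) (h.perm σ)
  simp only [s0, s1, s2, s3] at hσ
  -- dehomogenise with respect to the first variable
  have hdeh := hσ.map (φ := (MvPolynomial.finSuccEquiv k 2).toRingEquiv.toRingHom)
    (MvPolynomial.finSuccEquiv k 2).injective
  have eC (x : k) : (MvPolynomial.finSuccEquiv k 2).toRingEquiv.toRingHom (MvPolynomial.C x) =
      C (MvPolynomial.C x) := by simp [MvPolynomial.finSuccEquiv_apply]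
  have eX0 : (MvPolynomial.finSuccEquiv k 2).toRingEquiv.toRingHom (MvPolynomial.X 0) = X :=
    MvPolynomial.finSuccEquiv_X_zero
  have eX1 : (MvPolynomial.finSuccEquiv k 2).toRingEquiv.toRingHom (MvPolynomial.X 1) =
      C (MvPolynomial.X 0) := MvPolynomial.finSuccEquiv_X_succ (j := 0)
  have eX2 : (MvPolynomial.finSuccEquiv k 2).toRingEquiv.toRingHom (MvPolynomial.X 2) =
      C (MvPolynomial.X 1) := MvPolynomial.finSuccEquiv_X_succ (j := 1)
  simp only [map_add, map_mul, map_pow, eC, eX0, eX1, eX2] at hdeh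
  have haff := hdeh.eval 1
  simp only [eval_add, eval_mul, eval_pow, eval_C, eval_X] at haff
  set θ : MvPolynomial (Fin 2) k →+* k[X][X] :=
    MvPolynomial.eval₂Hom (C.comp C) ![X, C X] with hθ
  have hθinj : Function.Injective θ := by
    have : (eval₂RingHom (eval₂RingHom MvPolynomial.C (MvPolynomial.X 1))
        (MvPolynomial.X 0)).comp θ = RingHom.id _ := by
      apply MvPolynomial.ringHom_ext
      · simp [hθ]
      · intro i
        fin_cases i <;> simp [hθ]
    exact Function.LeftInverse.injective fun p => RingHom.congr_fun this p
  have hθF : Function.Injective ((mapRingHom (algebraMap k[X] F)).comp θ) :=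
    (map_injective _ (IsFractionRing.injective k[X] F)).comp hθinj
  obtain ⟨A, B, hAB, hsum, horth⟩ := haff.map hθF
  have fC (x : k) : (mapRingHom (algebraMap k[X] F)).comp θ (MvPolynomial.C x) =
      C (algebraMap k[X] F (C x)) := by simp [hθ]
  have fX0 : (mapRingHom (algebraMap k[X] F)).comp θ (MvPolynomial.X 0) = X := by simp [hθ]
  have fX1 : (mapRingHom (algebraMap k[X] F)).comp θ (MvPolynomial.X 1) =
      C (algebraMap k[X] F X) := by simp [hθ]
  simp only [map_add, map_mul, map_pow, map_one, fC, fX0, fX1] at hsum horth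
  set j : k →+* F := (algebraMap k[X] F).comp C with hj
  have hjC (x : k) : algebraMap k[X] F (C x) = j x := rfl
  have hjinj : Function.Injective j := j.injective
  have hj0 (i : Fin 4) : j (a i) ≠ 0 := by
    simpa using ha.ne_zero i
  set Z : F := algebraMap k[X] F X with hZ
  have haF : DiagAniso fun i => j (a i) := ha.polynomial.fractionRing (F := F)
  have hbF : DiagAniso fun i => j (b i) := hb.polynomial.fractionRing (F := F)
  simp only [hjC] at hsum horth
  have hdiv (i : Fin 4) : j (-a i / a 0) = -j (a i) / j (a 0) := by
    rw [map_div₀, map_neg]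
  have h2F : (2 : F) ≠ 0 := by
    intro h0
    apply h2
    apply hjinj
    rw [map_ofNat, map_zero, h0]
  have hg0 : j (a 2) * Z ^ 2 + j (a 3) ≠ 0 := by
    intro h0
    have := congrFun (haF ![0, 0, Z, 1] (by simpa [Fin.sum_univ_four] using h0)) 3
    simp at this
  obtain ⟨u, c, hc, h00, h11, h22, h01, h02, h12⟩ :=
    exists_orthogonal_triple (α := -j (a 1) / j (a 0))
      (β := -(j (a 2) * Z ^ 2 + j (a 3)) / j (a 0)) h2F (fun r hr => by
        have := congrFun (haF ![r, 1, 0, 0] (by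
          simp only [Fin.sum_univ_four]
          have := hj0 0
          field_simp at hr
          simp
          linear_combination hr)) 1
        simp at this) (fun x y hxy => by
        have := congrFun (haF ![y, x, Z, 1] (by
          simp only [Fin.sum_univ_four]
          have := hj0 0
          field_simp at hxy
          simp
          linear_combination hxy)) 3
        simp at this) hbF hAB (by
        rw [← hsum]
        congr 2
        have e : -(j (a 2) * Z ^ 2 + j (a 3)) / j (a 0) =
            -j (a 3) / j (a 0) + -j (a 2) / j (a 0) * Z ^ 2 := by ring
        rw [hdiv, hdiv, hdiv, e, C_add, C_mul, C_pow]
        ring) horth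
  obtain ⟨U, hU⟩ := exists_gram_of_triple (c := c / j (a 0)) (hj0 0) (hj0 1) hg0
    (div_ne_zero hc (hj0 0)) hbF u (by rw [h00, div_mul_cancel₀ _ (hj0 0)])
    (by rw [h11]; ring) (by rw [h22]; ring) h01 h02 h12
  refine ⟨U, c / j (a 0), div_ne_zero hc (hj0 0), hU.trans ?_⟩
  congr 1
  funext i
  fin_cases i <;> simp [hjC, hZ]

theorem RationalMap.exists_similitude (h2 : (2 : k) ≠ 0) {a b : Fin 4 → k} (ha : DiagAniso a)
    (hb : DiagAniso b) (h : RationalMap a b) (h' : RationalMap b a) :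
    ∃ (M : Matrix (Fin 4) (Fin 4) k) (c : k), c ≠ 0 ∧
      M * Matrix.diagonal b * M.transpose = Matrix.diagonal fun i => c * a i := by
  obtain ⟨U, c, hc, hU⟩ := h.exists_gram (FractionRing k[X]) h2 ha hb
  obtain ⟨U', c', hc', hU'⟩ := h'.exists_gram (FractionRing k[X]) h2 hb ha
  have hsq : ∃ r, r ^ 2 = (∏ i, a i) * ∏ i, b i := by
    rcases disc_dichotomy h2 ha hb hc hU with ⟨r, hr⟩ | hr
    · rcases disc_dichotomy h2 hb ha hc' hU' with ⟨s, hs⟩ | hs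
      · exact ⟨r * s, by rw [mul_pow, hr, hs]⟩
      · rwa [mul_comm] at hs
    · exact hr
  obtain ⟨V, hV⟩ := gram_of_disc_eq ha hb hsq hU
  obtain ⟨Y, e, he, hY⟩ := exists_integral_gram hc hV
  exact exists_gram_of_polynomial_gram ha hb he Y hY

end Isotropic

section Diagonalization

variable {k : Type*} [Field k]

/-- `q` becomes `⟨a₀, a₁, a₂, a₃⟩` in the coordinates given by the invertible matrix `M`, whose
inverse is `N`. -/
structure Diagonalizes (q : QuadraticForm k (Fin 4 → k)) (a : Fin 4 → k)
    (M N : Matrix (Fin 4) (Fin 4) k) : Prop where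
  ne_zero : ∀ i, a i ≠ 0
  mul_inv : M * N = 1
  inv_mul : N * M = 1
  form_eq : ∀ x, q x = ∑ l, a l * (M.mulVec x) l ^ 2

theorem exists_diagonalizes (h2 : (2 : k) ≠ 0) (q : QuadraticForm k (Fin 4 → k))
    (hq : NondegQF q) : ∃ a M N, Diagonalizes q a M N := by
  have := invertibleOfNonzero h2
  have hsep : LinearMap.SeparatingLeft (QuadraticMap.associated (R := k) q) := by
    intro x hx
    by_contra hx0
    refine hq (Matrix.exists_mulVec_eq_zero_iff.1 ⟨x, hx0, ?_⟩)
    funext i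
    have h1 : q.polarBilin x (Pi.single i 1) = 0 := by
      rw [← QuadraticMap.two_nsmul_associated k, LinearMap.smul_apply, LinearMap.smul_apply, hx,
        smul_zero]
    have h3 : x = ∑ j, x j • (Pi.single j 1 : Fin 4 → k) := pi_eq_sum_univ' x
    rw [h3, map_sum, LinearMap.sum_apply] at h1
    rw [Pi.zero_apply, ← h1]
    simp only [Matrix.mulVec, dotProduct, polarMatrix, Matrix.of_apply, map_smul,
      LinearMap.smul_apply, smul_eq_mul, QuadraticMap.polarBilin_apply_apply]
    exact Finset.sum_congr rfl fun j _ => by rw [mul_comm, QuadraticMap.polar_comm]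
  obtain ⟨w, ⟨e⟩⟩ := QuadraticForm.equivalent_weightedSumSquares_units_of_nondegenerate' q hsep
  have hn : Module.finrank k (Fin 4 → k) = 4 := by simp
  generalize Module.finrank k (Fin 4 → k) = n at hn w e
  subst hn
  refine ⟨fun i => w i, LinearMap.toMatrix' e.toLinearEquiv.toLinearMap,
    LinearMap.toMatrix' e.toLinearEquiv.symm.toLinearMap, fun i => (w i).ne_zero, ?_, ?_, ?_⟩
  · rw [← LinearMap.toMatrix'_comp, LinearEquiv.comp_symm, LinearMap.toMatrix'_id]
  · rw [← LinearMap.toMatrix'_comp, LinearEquiv.symm_comp, LinearMap.toMatrix'_id]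
  · intro x
    have := e.map_app x
    rw [← this, QuadraticMap.weightedSumSquares_apply]
    refine Finset.sum_congr rfl fun i _ => ?_
    rw [LinearMap.toMatrix'_mulVec, Units.smul_def, smul_eq_mul, pow_two]
    rfl

variable {q : QuadraticForm k (Fin 4 → k)} {a : Fin 4 → k} {M N : Matrix (Fin 4) (Fin 4) k}

theorem Diagonalizes.anisotropic_iff (h : Diagonalizes q a M N) :
    q.Anisotropic ↔ DiagAniso a := by
  constructor
  · intro hq x hx
    have h0 : N.mulVec x = 0 := hq _ (by
      rw [h.form_eq, Matrix.mulVec_mulVec, h.mul_inv, Matrix.one_mulVec, hx])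
    rw [← Matrix.one_mulVec x, ← h.mul_inv, ← Matrix.mulVec_mulVec, h0, Matrix.mulVec_zero]
  · intro ha x hx
    have h0 : M.mulVec x = 0 := ha _ (by rw [← h.form_eq, hx])
    rw [← Matrix.one_mulVec x, ← h.inv_mul, ← Matrix.mulVec_mulVec, h0, Matrix.mulVec_zero]

theorem Diagonalizes.extendQF_apply (h : Diagonalizes q a M N) (L : Type*) [CommRing L]
    [Algebra k L] (x : Fin 4 → L) :
    extendQF q L x = ∑ l, algebraMap k L (a l) * (∑ i, algebraMap k L (M l i) * x i) ^ 2 := by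
  have hpol (i j : Fin 4) : QuadraticMap.polar q (Pi.single i 1) (Pi.single j 1) =
      ∑ l, 2 * a l * M l i * M l j := by
    simp only [QuadraticMap.polar, h.form_eq, Matrix.mulVec_add, Pi.add_apply,
      Matrix.mulVec_single_one, Matrix.col_apply, ← Finset.sum_sub_distrib]
    exact Finset.sum_congr rfl fun l _ => by ring
  have hdiag (i : Fin 4) : q (Pi.single i 1) = ∑ l, a l * M l i ^ 2 := by
    simp [h.form_eq]
  have e : extendQF q L x = ∑ i, ∑ j, x i * (x j * algebraMap k L (coeffMatrix q i j)) := by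
    change Matrix.toQuadraticForm' _ x = _
    simp [Matrix.toQuadraticForm', Matrix.toLinearMap₂'_apply]
  rw [e]
  simp only [coeffMatrix, Matrix.of_apply, hpol, hdiag, Fin.sum_univ_four]
  have htwo : algebraMap k L 2 = 2 := map_ofNat _ 2
  simp [htwo]
  ring

end Diagonalization

section GenericPoint
open MvPolynomial

variable {k : Type*} [Field k]

/-- The generic point `(X₀, X₁, X₂, 1)` of the affine chart. -/
def affinePoint (k : Type*) [Field k] : Fin 4 → MvPolynomial (Fin (4 - 1)) k :=
  fun i => if h : (i : ℕ) < 4 - 1 then X ⟨i, h⟩ else 1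

variable {q q' : QuadraticForm k (Fin 4 → k)} {a b : Fin 4 → k}
  {M N M' N' : Matrix (Fin 4) (Fin 4) k}

theorem Diagonalizes.affineQuadricPoly_eq (h : Diagonalizes q a M N) :
    affineQuadricPoly q = ∑ l, C (a l) * (∑ i, C (M l i) * affinePoint k i) ^ 2 :=
  h.extendQF_apply _ _

theorem Diagonalizes.not_isUnit (h2 : (2 : k) ≠ 0) (h : Diagonalizes q a M N) :
    ¬ IsUnit (affineQuadricPoly q) := by
  rw [isUnit_iff_eq_C_of_isReduced]
  rintro ⟨r, -, hr⟩
  have hval (x y z : k) :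
      ∑ l, a l * (M l 0 * x + M l 1 * y + M l 2 * z + M l 3) ^ 2 = r := by
    have := congrArg (MvPolynomial.eval ![x, y, z]) hr
    simpa [h.affineQuadricPoly_eq, affinePoint, Fin.sum_univ_four] using this
  have h000 := hval 0 0 0
  have hcol (j : Fin 4) : ∑ l, (a l * M l 0) * M l j = 0 := by
    apply mul_left_cancel₀ h2
    apply mul_left_cancel₀ h2
    have e1 := hval 1 0 0
    have e2 := hval (-1) 0 0
    have e3 := hval 0 1 0
    have e4 := hval 1 1 0
    have e5 := hval 0 0 1
    have e6 := hval 1 0 1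
    simp only [Fin.sum_univ_four] at *
    fin_cases j <;> simp only [Fin.zero_eta, Fin.mk_one, Fin.reduceFinMk, mul_zero]
    · linear_combination 2 * e1 + 2 * e2 - 4 * h000
    · linear_combination 2 * e4 - 2 * e1 - 2 * e3 + 2 * h000
    · linear_combination 2 * e6 - 2 * e1 - 2 * e5 + 2 * h000
    · linear_combination e1 - e2
  have hvec : Matrix.vecMul (fun l => a l * M l 0) M = 0 := funext hcol
  have h0 : (fun l => a l * M l 0) = 0 := by
    rw [← Matrix.vecMul_one (fun l => a l * M l 0), ← h.mul_inv, ← Matrix.vecMul_vecMul, hvec,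
      Matrix.zero_vecMul]
  have hM (l : Fin 4) : M l 0 = 0 := by
    simpa [h.ne_zero l] using congrFun h0 l
  have := congrFun (congrFun h.inv_mul 0) 0
  simp [Matrix.mul_apply, hM] at this

/-- A `k`-homomorphism of function fields yields, after clearing denominators, a point of the
second quadric with polynomial coordinates on the first one. -/
theorem exists_polynomial_point (h2 : (2 : k) ≠ 0) (h : Diagonalizes q a M N)
    (h' : Diagonalizes q' b M' N')
    (φ : quadricFunctionField q' →ₐ[k] quadricFunctionField q) :
    ∃ p : Fin 4 → MvPolynomial (Fin (4 - 1)) k,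
      affineQuadricPoly q ∣ ∑ l, C (b l) * p l ^ 2 ∧ ∃ l, ¬ affineQuadricPoly q ∣ p l := by
  have hnt : Nontrivial (quadricCoordRing q) := by
    rw [Ideal.Quotient.nontrivial_iff]
    exact fun h0 => h.not_isUnit h2 (Ideal.span_singleton_eq_top.1 h0)
  have hntK : Nontrivial (quadricFunctionField q) :=
    (IsFractionRing.injective (quadricCoordRing q) (quadricFunctionField q)).nontrivial
  set π' : MvPolynomial (Fin (4 - 1)) k →ₐ[k] quadricFunctionField q' :=
    (Algebra.ofId (quadricCoordRing q') (quadricFunctionField q')).restrictScalars k |>.comp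
      (Ideal.Quotient.mkₐ k _) with hπ'
  set ξ : Fin 4 → quadricFunctionField q := fun i => φ (π' (affinePoint k i)) with hξ
  have hξ3 : ξ 3 = 1 := by simp [hξ, affinePoint]
  set η : Fin 4 → quadricFunctionField q :=
    fun l => ∑ i, algebraMap k _ (M' l i) * ξ i with hη
  have hC (x : k) : φ (π' (C x)) = algebraMap k _ x := by
    rw [← MvPolynomial.algebraMap_eq, AlgHom.commutes, AlgHom.commutes]
  have hπf : π' (affineQuadricPoly q') = 0 := by
    have : Ideal.Quotient.mkₐ k (Ideal.span {affineQuadricPoly q'}) (affineQuadricPoly q') = 0 :=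
      Ideal.Quotient.eq_zero_iff_mem.2 (Ideal.mem_span_singleton_self _)
    rw [hπ', AlgHom.comp_apply, this, map_zero]
  have hηsum : ∑ l, algebraMap k _ (b l) * η l ^ 2 = 0 := by
    have := (congrArg (fun p => φ (π' p)) h'.affineQuadricPoly_eq).symm.trans
      ((congrArg φ hπf).trans (map_zero φ))
    simpa only [map_sum, map_mul, map_pow, hC] using this
  have hη0 : ∃ l, η l ≠ 0 := by
    by_contra! h0
    have hN : ∑ l, algebraMap k (quadricFunctionField q) (N' 3 l) * η l = ξ 3 := by
      have e (i : Fin 4) : ∑ l, N' 3 l * M' l i = (1 : Matrix (Fin 4) (Fin 4) k) 3 i := by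
        rw [← h'.inv_mul, Matrix.mul_apply]
      simp only [hη, Finset.mul_sum]
      rw [Finset.sum_comm]
      simp only [← mul_assoc, ← map_mul, ← Finset.sum_mul, ← map_sum, e]
      simp [Matrix.one_apply]
    simp [h0, hξ3] at hN
  obtain ⟨s, hs⟩ := IsLocalization.exist_integer_multiples_of_finite
    (nonZeroDivisors (quadricCoordRing q)) η
  choose y hy using hs
  have hinj := IsFractionRing.injective (quadricCoordRing q) (quadricFunctionField q)
  have hsu : IsUnit (algebraMap (quadricCoordRing q) (quadricFunctionField q) s) :=
    IsLocalization.map_units _ s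
  have hy' (l : Fin 4) : algebraMap (quadricCoordRing q) (quadricFunctionField q) (y l) =
      algebraMap _ _ (s : quadricCoordRing q) * η l := by
    rw [hy, Algebra.smul_def]
  have hysum : ∑ l, algebraMap k (quadricCoordRing q) (b l) * y l ^ 2 = 0 := by
    apply hinj
    simp only [map_sum, map_mul, map_pow, hy', map_zero, ← IsScalarTower.algebraMap_apply]
    have e (l : Fin 4) : algebraMap k (quadricFunctionField q) (b l) *
        (algebraMap _ _ (s : quadricCoordRing q) * η l) ^ 2 =
        algebraMap _ _ (s : quadricCoordRing q) ^ 2 * (algebraMap k _ (b l) * η l ^ 2) := by ring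
    simp only [e]
    rw [← Finset.mul_sum, hηsum, mul_zero]
  choose p hp using fun l => Ideal.Quotient.mk_surjective (y l)
  refine ⟨p, ?_, ?_⟩
  · rw [← Ideal.mem_span_singleton, ← Ideal.Quotient.eq_zero_iff_mem, ← hysum]
    simp only [map_sum, map_mul, map_pow, hp]
    rfl
  · obtain ⟨l, hl⟩ := hη0
    refine ⟨l, fun hdvd => hl ?_⟩
    rw [← Ideal.mem_span_singleton, ← Ideal.Quotient.eq_zero_iff_mem, hp] at hdvd
    have := hy' l
    rw [hdvd, map_zero] at this
    exact hsu.mul_right_eq_zero.1 this.symm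

end GenericPoint

section Homogenization
open MvPolynomial

variable {k : Type*} [Field k]

/-- Restriction to the affine chart, in the coordinates given by `M`. -/
def dehomogenize (M : Matrix (Fin 4) (Fin 4) k) :
    MvPolynomial (Fin 4) k →ₐ[k] MvPolynomial (Fin (4 - 1)) k :=
  aeval fun l => ∑ i, C (M l i) * affinePoint k i

/-- The linear form `∑ l, N i l * X l`. -/
def linForm (N : Matrix (Fin 4) (Fin 4) k) (i : Fin 4) : MvPolynomial (Fin 4) k :=
  ∑ l, C (N i l) * X l

/-- The substitution `X i ↦ linForm N i / linForm N 3`. -/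
def homogenize (N : Matrix (Fin 4) (Fin 4) k) :
    MvPolynomial (Fin (4 - 1)) k →ₐ[k] FractionRing (MvPolynomial (Fin 4) k) :=
  aeval fun i => algebraMap (MvPolynomial (Fin 4) k) _ (linForm N (Fin.castSucc i)) /
    algebraMap (MvPolynomial (Fin 4) k) _ (linForm N 3)

variable {M N : Matrix (Fin 4) (Fin 4) k}

theorem homogenize_C (x : k) :
    homogenize N (C x) = algebraMap (MvPolynomial (Fin 4) k) _ (C x) := by
  rw [← MvPolynomial.algebraMap_eq, AlgHom.commutes, ← MvPolynomial.algebraMap_eq,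
    ← IsScalarTower.algebraMap_apply]

theorem dehomogenize_linForm (h : N * M = 1) (i : Fin 4) :
    dehomogenize M (linForm N i) = affinePoint k i := by
  have e (j : Fin 4) : ∑ l, N i l * M l j = (1 : Matrix (Fin 4) (Fin 4) k) i j := by
    rw [← h, Matrix.mul_apply]
  simp only [linForm, dehomogenize, map_sum, map_mul, algHom_C, aeval_X, algebraMap_eq,
    Finset.mul_sum]
  rw [Finset.sum_comm]
  simp only [← mul_assoc, ← C_mul, ← Finset.sum_mul, ← map_sum, e]
  simp [Matrix.one_apply]

theorem sum_mul_linForm (h : M * N = 1) (l : Fin 4) : ∑ i, C (M l i) * linForm N i = X l := by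
  have e (j : Fin 4) : ∑ i, M l i * N i j = (1 : Matrix (Fin 4) (Fin 4) k) l j := by
    rw [← h, Matrix.mul_apply]
  simp only [linForm, Finset.mul_sum]
  rw [Finset.sum_comm]
  simp only [← mul_assoc, ← C_mul, ← Finset.sum_mul, ← map_sum, e]
  simp [Matrix.one_apply]

theorem linForm_three_ne_zero (h : N * M = 1) : linForm N 3 ≠ 0 := by
  intro h0
  have := dehomogenize_linForm h 3
  rw [h0, map_zero] at this
  simp [affinePoint] at this

theorem algebraMap_linForm_three_ne_zero (h : N * M = 1) :
    algebraMap (MvPolynomial (Fin 4) k) (FractionRing (MvPolynomial (Fin 4) k)) (linForm N 3) ≠ 0 :=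
  fun h0 => linForm_three_ne_zero h
    (IsFractionRing.injective _ (FractionRing (MvPolynomial (Fin 4) k)) (by rw [h0, map_zero]))

theorem homogenize_affinePoint (h : N * M = 1) (i : Fin 4) :
    homogenize N (affinePoint k i) = algebraMap (MvPolynomial (Fin 4) k) _ (linForm N i) /
      algebraMap (MvPolynomial (Fin 4) k) _ (linForm N 3) := by
  have h3 := algebraMap_linForm_three_ne_zero h
  fin_cases i
  · simp [affinePoint, homogenize]
  · simp [affinePoint, homogenize]
  · simp [affinePoint, homogenize]
  · simp [affinePoint, h3]

theorem exists_homogenization (h : N * M = 1) (p : MvPolynomial (Fin (4 - 1)) k) :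
    ∃ (n : ℕ) (P : MvPolynomial (Fin 4) k),
      algebraMap _ (FractionRing (MvPolynomial (Fin 4) k)) P =
        algebraMap _ _ (linForm N 3) ^ n * homogenize N p ∧ dehomogenize M P = p := by
  have h3 := algebraMap_linForm_three_ne_zero h
  have hd3 : dehomogenize M (linForm N 3) = 1 := by
    rw [dehomogenize_linForm h]; simp [affinePoint]
  induction p using MvPolynomial.induction_on with
  | C x =>
    refine ⟨0, C x, ?_, ?_⟩
    · rw [pow_zero, one_mul, homogenize_C]
    · simp [← MvPolynomial.algebraMap_eq]
  | add p₁ p₂ ih₁ ih₂ =>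
    obtain ⟨n₁, P₁, e₁, d₁⟩ := ih₁
    obtain ⟨n₂, P₂, e₂, d₂⟩ := ih₂
    refine ⟨n₁ + n₂, linForm N 3 ^ n₂ * P₁ + linForm N 3 ^ n₁ * P₂, ?_, ?_⟩
    · simp only [map_add, map_mul, map_pow, e₁, e₂]
      ring
    · simp [d₁, d₂, hd3]
  | mul_X p i ih =>
    obtain ⟨n, P, e, d⟩ := ih
    refine ⟨n + 1, P * linForm N (Fin.castSucc i), ?_, ?_⟩
    · have hX : homogenize N (X i) = algebraMap (MvPolynomial (Fin 4) k) _
          (linForm N (Fin.castSucc i)) / algebraMap (MvPolynomial (Fin 4) k) _ (linForm N 3) := by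
        simp [homogenize]
      rw [map_mul, map_mul, e, hX]
      field_simp
      ring
    · rw [map_mul, d, dehomogenize_linForm h]
      simp [affinePoint]

theorem exists_homogenization_family (h : N * M = 1)
    (p : Fin 4 → MvPolynomial (Fin (4 - 1)) k) :
    ∃ (n : ℕ) (P : Fin 4 → MvPolynomial (Fin 4) k), ∀ l,
      algebraMap _ (FractionRing (MvPolynomial (Fin 4) k)) (P l) =
        algebraMap _ _ (linForm N 3) ^ n * homogenize N (p l) ∧ dehomogenize M (P l) = p l := by
  have hd3 : dehomogenize M (linForm N 3) = 1 := by
    rw [dehomogenize_linForm h]; simp [affinePoint]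
  choose n P hP hd using fun l => exists_homogenization h (p l)
  refine ⟨∑ l, n l, fun l => linForm N 3 ^ (∑ l, n l - n l) * P l, fun l => ⟨?_, ?_⟩⟩
  · have hle : n l ≤ ∑ l, n l := Finset.single_le_sum (fun _ _ => Nat.zero_le _) (Finset.mem_univ l)
    rw [map_mul, hP, map_pow, ← mul_assoc, ← pow_add, Nat.sub_add_cancel hle]
  · simp [hd, hd3]

theorem rationalMap_of_hom {q q' : QuadraticForm k (Fin 4 → k)} {a b : Fin 4 → k}
    {M' N' : Matrix (Fin 4) (Fin 4) k} (h2 : (2 : k) ≠ 0) (h : Diagonalizes q a M N)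
    (h' : Diagonalizes q' b M' N')
    (φ : quadricFunctionField q' →ₐ[k] quadricFunctionField q) : RationalMap a b := by
  obtain ⟨p, ⟨r, hr⟩, l, hl⟩ := exists_polynomial_point h2 h h' φ
  obtain ⟨n, P, hP⟩ := exists_homogenization_family h.inv_mul p
  obtain ⟨m, R, hR, -⟩ := exists_homogenization h.inv_mul r
  have h3 := algebraMap_linForm_three_ne_zero h.inv_mul
  have hd3 : dehomogenize M (linForm N 3) = 1 := by
    rw [dehomogenize_linForm h.inv_mul]; simp [affinePoint]
  have hdQ : dehomogenize M (diagPoly a) = affineQuadricPoly q := by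
    rw [h.affineQuadricPoly_eq]
    simp [diagPoly, dehomogenize]
  have hlin (l : Fin 4) : homogenize N (∑ i, C (M l i) * affinePoint k i) =
      algebraMap (MvPolynomial (Fin 4) k) _ (X l) /
        algebraMap (MvPolynomial (Fin 4) k) _ (linForm N 3) := by
    rw [← sum_mul_linForm h.mul_inv l]
    simp only [map_sum, map_mul, homogenize_C, homogenize_affinePoint h.inv_mul, Finset.sum_div,
      mul_div_assoc]
  have hQ : homogenize N (affineQuadricPoly q) *
      algebraMap (MvPolynomial (Fin 4) k) _ (linForm N 3) ^ 2 =
      algebraMap (MvPolynomial (Fin 4) k) _ (diagPoly a) := by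
    rw [h.affineQuadricPoly_eq, diagPoly, map_sum, map_sum, Finset.sum_mul]
    refine Finset.sum_congr rfl fun l _ => ?_
    rw [map_mul, map_pow, hlin, homogenize_C, map_mul, map_pow]
    field_simp
  refine ⟨fun l => linForm N 3 ^ (m + 2) * P l, ⟨linForm N 3 ^ (m + 2) * linForm N 3 ^ (2 * n) * R,
    ?_⟩, l, fun hdvd => hl ?_⟩
  · apply IsFractionRing.injective _ (FractionRing (MvPolynomial (Fin 4) k))
    have hr' := congrArg (homogenize N) hr
    simp only [map_sum, map_mul, map_pow, homogenize_C] at hr'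
    simp only [map_sum, map_mul, map_pow, (hP _).1, hR, ← hQ]
    set t := algebraMap (MvPolynomial (Fin 4) k) (FractionRing (MvPolynomial (Fin 4) k))
      (linForm N 3)
    simp only [Fin.sum_univ_four] at hr' ⊢
    linear_combination (t ^ (m + 2) * t ^ n) ^ 2 * hr'
  · have := map_dvd (dehomogenize M) hdvd
    simpa [hdQ, hd3, (hP l).2] using this

end Homogenization

section Similarity

variable {k : Type*} [Field k] {q q' : QuadraticForm k (Fin 4 → k)} {a b : Fin 4 → k}
  {M N M' N' : Matrix (Fin 4) (Fin 4) k}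

theorem Diagonalizes.similarQF (h : Diagonalizes q a M N) (h' : Diagonalizes q' b M' N')
    {U : Matrix (Fin 4) (Fin 4) k} {c : k} (hc : c ≠ 0)
    (hU : U * Matrix.diagonal b * U.transpose = Matrix.diagonal fun i => c * a i) :
    SimilarQF q q' := by
  have hdet : IsUnit (N' * U.transpose * M).det := by
    have h1 := congrArg Matrix.det hU
    have h2 := congrArg Matrix.det h.inv_mul
    have h3 := congrArg Matrix.det h'.inv_mul
    simp only [Matrix.det_mul, Matrix.det_transpose, Matrix.det_diagonal, Matrix.det_one] at *
    have hne : ∏ i, c * a i ≠ 0 := Finset.prod_ne_zero_iff.2 fun i _ => mul_ne_zero hc (h.ne_zero i)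
    rw [← h1] at hne
    refine (mul_ne_zero (mul_ne_zero ?_ (right_ne_zero_of_mul hne)) ?_).isUnit
    · exact left_ne_zero_of_mul (h3.trans_ne one_ne_zero)
    · exact right_ne_zero_of_mul (h2.trans_ne one_ne_zero)
  refine ⟨c, hc.isUnit, ⟨⟨Matrix.toLinearEquiv' _ (Matrix.invertibleOfIsUnitDet _ hdet),
    fun x => ?_⟩⟩⟩
  change q' ((N' * U.transpose * M).mulVec x) = _
  rw [h'.form_eq, Matrix.mulVec_mulVec, ← Matrix.mul_assoc, ← Matrix.mul_assoc, h'.mul_inv,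
    Matrix.one_mul, ← Matrix.mulVec_mulVec, _root_.smul_apply, h.form_eq]
  generalize M.mulVec x = y
  have e (b y : Fin 4 → k) : ∑ l, b l * y l ^ 2 = y ⬝ᵥ (Matrix.diagonal b).mulVec y := by
    simp only [dotProduct, Matrix.mulVec_diagonal]
    exact Finset.sum_congr rfl fun l _ => by ring
  have hsmul : c • ∑ l, a l * y l ^ 2 = ∑ l, c * a l * y l ^ 2 := by
    simp only [smul_eq_mul, Finset.mul_sum, mul_assoc]
  rw [hsmul, e, e (fun l => c * a l), ← hU, ← Matrix.mulVec_mulVec, ← Matrix.mulVec_mulVec,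
    Matrix.dotProduct_mulVec y U, ← Matrix.mulVec_transpose]

end Similarity

end QuadricIsogeny

theorem stmt_6 (k : Type u) [Field k] (h2 : (2 : k) ≠ 0)
    (q q' : QuadraticForm k (Fin 4 → k)) (hq : NondegQF q) (hq' : NondegQF q')
    (hom₁ : Nonempty (quadricFunctionField q →ₐ[k] quadricFunctionField q'))
    (hom₂ : Nonempty (quadricFunctionField q' →ₐ[k] quadricFunctionField q)) :
    (¬q.Anisotropic ∧ ¬q'.Anisotropic) ∨ SimilarQF q q' := by
  obtain ⟨a, M, N, h⟩ := QuadricIsogeny.exists_diagonalizes h2 q hq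
  obtain ⟨b, M', N', h'⟩ := QuadricIsogeny.exists_diagonalizes h2 q' hq'
  obtain ⟨φ⟩ := hom₁
  obtain ⟨ψ⟩ := hom₂
  have hab := QuadricIsogeny.rationalMap_of_hom h2 h h' ψ
  have hba := QuadricIsogeny.rationalMap_of_hom h2 h' h φ
  rw [h.anisotropic_iff, h'.anisotropic_iff]
  by_cases ha : QuadricIsogeny.DiagAniso a
  · by_cases hb : QuadricIsogeny.DiagAniso b
    · obtain ⟨U, c, hc, hU⟩ := hab.exists_similitude h2 ha hb hba
      exact Or.inr (h.similarQF h' hc hU)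
    · exact absurd ha (hba.not_diagAniso h2 h'.ne_zero hb)
  · exact Or.inl ⟨ha, hab.not_diagAniso h2 h.ne_zero ha⟩

end
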